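/- arXiv:2209.08134 — 2 statements merged into one kernel-verified Lean document; each statement's English description precedes it below -/
import Mathlib

section
/- There exist constants L and C such that the following holds for every n: if H is a 3-uniform hypergraph on n vertices that contains no pseudocycle of length ℓ for any ℓ ≤ L with ℓ not divisible by 3, then e(H) ≤ f(n) + C. -/
/-- `f 0 = f 1 = 0` and, for `n ≥ 2`,
`f n = max over 1 ≤ k ≤ n − 1 of (k choose 2)·(n − k) + f (n − k)`
(here `k = j + 1` ranges over `1, …, n − 1`). -/
def f : ℕ → ℕ
  | 0 => 0
  | 1 => 0
  | n + 2 =>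
    (Finset.range (n + 1)).sup fun j =>
      Nat.choose (j + 1) 2 * (n + 1 - j) + f (n + 1 - j)
  decreasing_by omega
/-- `H` has a pseudocycle of length `ℓ`: a sequence of vertices indexed by `ZMod ℓ`
such that every three cyclically consecutive vertices form an edge of `H`. -/
def HasPseudocycle {V : Type} [DecidableEq V] (H : Finset (Finset V)) (ℓ : ℕ) : Prop :=
  ∃ v : ZMod ℓ → V, ∀ i : ZMod ℓ, ({v i, v (i + 1), v (i + 2)} : Finset V) ∈ H

namespace PC

theorem f_ge (n k : ℕ) (hk : 1 ≤ k) (hkn : k + 1 ≤ n) :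
    Nat.choose k 2 * (n - k) + f (n - k) ≤ f n := by
  obtain ⟨n, rfl⟩ : ∃ m, n = m + 2 := ⟨n - 2, by omega⟩
  obtain ⟨j, rfl⟩ : ∃ j, k = j + 1 := ⟨k - 1, by omega⟩
  have h := Finset.le_sup (s := Finset.range (n + 1))
    (f := fun j => Nat.choose (j + 1) 2 * (n + 1 - j) + f (n + 1 - j))
    (b := j) (by simp; omega)
  rw [f]
  have e : n + 2 - (j + 1) = n + 1 - j := by omega
  rw [e]
  exact h

/-- the density constant -/
noncomputable def A : ℝ := (2 * √3 - 3) / 6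

theorem A_eq : 12 * A ^ 2 + 12 * A = 1 := by
  have h : (√3) ^ 2 = 3 := Real.sq_sqrt (by norm_num)
  unfold A
  nlinarith

theorem A_lb : (0.0773 : ℝ) < A := by
  have h : (1.732 : ℝ) < √3 := by
    apply Real.lt_sqrt_of_sq_lt; norm_num
  unfold A
  linarith

theorem A_ub : A < (0.0774 : ℝ) := by
  have h : √3 < (1.7321 : ℝ) := by
    rw [Real.sqrt_lt' (by norm_num)]; norm_num
  unfold A
  linarith

/-- optimal proportion -/
noncomputable def x0 : ℝ := (1 + 6 * A) / (2 * (1 + 2 * A))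

theorem x0_eq : 2 * (1 + 2 * A) * x0 = 1 + 6 * A := by
  have := A_lb
  unfold x0
  field_simp

theorem x0_lb : (0.633 : ℝ) < x0 := by
  have h1 := A_lb
  have h2 := A_ub
  unfold x0
  rw [lt_div_iff₀ (by linarith)]
  linarith

theorem x0_ub : x0 < (0.635 : ℝ) := by
  have h1 := A_lb
  have h2 := A_ub
  unfold x0
  rw [div_lt_iff₀ (by linarith)]
  linarith

theorem key_identity (n k : ℝ) :
    A * n ^ 3 - (k ^ 2 * (n - k) / 2 + A * (n - k) ^ 3)
      = (k / 2) * (1 + 2 * A) * (k - x0 * n) ^ 2 := by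
  have h1 := x0_eq
  have h2 := A_eq
  have h3 : (1 + 2 * A) * x0 ^ 2 = 6 * A := by
    have hA := A_lb
    have : (2 * (1 + 2 * A) * x0) ^ 2 = (1 + 6 * A) ^ 2 := by rw [h1]
    have h4 : (1 + 2 * A) * (4 * ((1 + 2 * A) * x0 ^ 2) - 4 * (6 * A)) = 0 := by
      nlinarith
    rcases mul_eq_zero.1 h4 with h | h
    · linarith
    · linarith
  have h5 : (k / 2) * (1 + 2 * A) * (k - x0 * n) ^ 2
      = (k / 2) * ((1 + 2 * A) * k ^ 2 - (2 * (1 + 2 * A) * x0) * k * n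
        + ((1 + 2 * A) * x0 ^ 2) * n ^ 2) := by ring
  rw [h5, h1, h3]
  ring

theorem f_lower (n : ℕ) : A * (n : ℝ) ^ 3 - 2 * (n : ℝ) ^ 2 ≤ f n := by
  induction n using Nat.strong_induction_on with
  | _ n ih =>
  have hA1 := A_lb
  have hA2 := A_ub
  have hx1 := x0_lb
  have hx2 := x0_ub
  by_cases hn : n ≤ 25
  · have : (n : ℝ) ≤ 25 := by exact_mod_cast hn
    have h2 : A * (n : ℝ) ^ 3 - 2 * (n : ℝ) ^ 2 ≤ 0 := by
      have : A * n ≤ 2 := by nlinarith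
      have : (n : ℝ) ^ 2 * (A * n - 2) ≤ 0 :=
        mul_nonpos_of_nonneg_of_nonpos (by positivity) (by linarith)
      nlinarith
    have h3 : (0 : ℝ) ≤ f n := by positivity
    linarith
  · push Not at hn
    have hn' : (26 : ℝ) ≤ n := by exact_mod_cast hn
    set k := ⌈x0 * n⌉₊ with hk
    have hk1 : x0 * n ≤ k := Nat.le_ceil _
    have hk2 : (k : ℝ) < x0 * n + 1 := Nat.ceil_lt_add_one (by positivity)
    have hk3 : 1 ≤ k := by
      have : (1 : ℝ) ≤ k := by nlinarith
      exact_mod_cast this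
    have hk4 : k + 1 ≤ n := by
      have : (k : ℝ) + 1 ≤ n := by nlinarith
      exact_mod_cast this
    have h1 := f_ge n k hk3 hk4
    have h2 := ih (n - k) (by omega)
    have h3 : ((Nat.choose k 2 * (n - k) + f (n - k) : ℕ) : ℝ) ≤ f n := by exact_mod_cast h1
    push_cast [Nat.cast_choose_two, Nat.cast_sub (show k ≤ n by omega)] at h3 h2
    have h4 := key_identity n k
    have h5 : (k - x0 * n) ^ 2 ≤ 1 := by nlinarith
    have h6 : ((k : ℝ) / 2) * (1 + 2 * A) * (k - x0 * n) ^ 2 ≤ ((k : ℝ) / 2) * (1 + 2 * A) * 1 :=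
      mul_le_mul_of_nonneg_left h5 (by positivity)
    have h7 : 0 ≤ (k : ℝ) * (2 * n + 1.5 * (n - k) - (1 + 2 * A) / 2) := by
      apply mul_nonneg (by positivity)
      have : (k : ℝ) + 1 ≤ n := by exact_mod_cast hk4
      nlinarith
    nlinarith

end PC

namespace PC
open Classical Finset

/-- real-valued indicator -/
noncomputable def ind (P : Prop) : ℝ := if P then 1 else 0

theorem ind_true {P : Prop} (h : P) : ind P = 1 := if_pos h
theorem ind_false {P : Prop} (h : ¬ P) : ind P = 0 := if_neg h
theorem ind_nonneg (P : Prop) : 0 ≤ ind P := by unfold ind; split_ifs <;> norm_num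
theorem ind_le_one (P : Prop) : ind P ≤ 1 := by unfold ind; split_ifs <;> norm_num
theorem ind_mono {P Q : Prop} (h : P → Q) : ind P ≤ ind Q := by
  by_cases hp : P
  · rw [ind_true hp, ind_true (h hp)]
  · rw [ind_false hp]; exact ind_nonneg _
theorem ind_and (P Q : Prop) : ind (P ∧ Q) = ind P * ind Q := by
  by_cases hp : P <;> by_cases hq : Q <;> simp [ind, hp, hq]
theorem ind_not (P : Prop) : ind (¬ P) = 1 - ind P := by
  by_cases hp : P <;> simp [ind, hp]
theorem ind_congr {P Q : Prop} (h : P ↔ Q) : ind P = ind Q := by rw [propext h]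

theorem zm3 : ∀ x : ZMod 3, x = 0 ∨ x = 1 ∨ x = -1 := by decide
theorem zm01 : ¬ ((0 : ZMod 3) = 1) := by decide
theorem zm02 : ¬ ((0 : ZMod 3) = -1) := by decide
theorem zm12 : ¬ ((1 : ZMod 3) = -1) := by decide
theorem zm21 : ¬ ((-1 : ZMod 3) = 1) := by decide

section
variable {V : Type}
/-- antisymmetric colouring -/
def Asym (d : V → V → ZMod 3) : Prop := ∀ a b, d b a = - d a b

theorem Asym.self {d : V → V → ZMod 3} (h : Asym d) (a : V) : d a a = 0 := by
  have := h a a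
  revert this
  generalize d a a = x
  revert x
  decide

/-- the map sending x to y and fixing everything else -/
noncomputable def sg (x y : V) : V → V := Function.update id x y

theorem sg_self (x y : V) : sg x y x = y := by simp [sg]
theorem sg_of_ne {x y u : V} (h : u ≠ x) : sg x y u = u := by simp [sg, h]

/-- convert x into a twin of y -/
noncomputable def conv (d : V → V → ZMod 3) (x y : V) : V → V → ZMod 3 :=
  fun u v => d (sg x y u) (sg x y v)

theorem Asym.conv {d : V → V → ZMod 3} (h : Asym d) (x y : V) : Asym (conv d x y) :=
  fun _ _ => h _ _

end

variable {V : Type} [Fintype V]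

theorem sum_ind_card (P : V → Prop) : ∑ a, ind (P a) = ((univ.filter P).card : ℝ) := by
  simp [ind]

theorem sum_sub (B : V → Prop) [I : Fintype {a // B a}] (F : V → ℝ) :
    ∑ a : {a // B a}, F a.1 = ∑ a, ind (B a) * F a := by
  have := Finset.sum_subtype (p := B) (F := I) (univ.filter B) (by simp) F
  rw [← this, Finset.sum_filter]
  simp [ind]

theorem card_sub (B : V → Prop) [Fintype {a // B a}] :
    ((Fintype.card {a // B a} : ℕ) : ℝ) = ∑ a, ind (B a) := by
  have := sum_sub B (fun _ => 1)
  simpa using this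

theorem sum_sg (x y : V) (F : V → ℝ) : ∑ a, F (sg x y a) = ∑ a, F a + F y - F x := by
  have h1 := Finset.add_sum_erase univ (fun a => F (sg x y a)) (mem_univ x)
  have h2 := Finset.add_sum_erase univ F (mem_univ x)
  have h3 : ∑ a ∈ univ.erase x, F (sg x y a) = ∑ a ∈ univ.erase x, F a := by
    apply Finset.sum_congr rfl
    intro a ha
    rw [sg_of_ne (Finset.ne_of_mem_erase ha)]
  simp only [sg_self] at h1
  linarith

/-- number of good triples (ordered blue pair, then target) -/
noncomputable def p (d : V → V → ZMod 3) : ℝ :=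
  ∑ a, ∑ b, ∑ c, ind (a ≠ b ∧ d a b = 0 ∧ d a c = -1 ∧ d b c = -1)

noncomputable def p3 (d : V → V → ZMod 3) (a b c : V) : ℝ :=
  ind (d a b = 0 ∧ d a c = -1 ∧ d b c = -1)
noncomputable def p2 (d : V → V → ZMod 3) (a c : V) : ℝ := ind (d a c = -1)

theorem p_eq {d : V → V → ZMod 3} (h : Asym d) :
    p d = ∑ a, ∑ b, ∑ c, p3 d a b c - ∑ a, ∑ c, p2 d a c := by
  unfold p
  rw [← Finset.sum_sub_distrib]
  apply Finset.sum_congr rfl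
  intro a _
  have : ∑ c, p2 d a c = ∑ b, ∑ c, ind (a = b) * p2 d a c := by
    simp_rw [← Finset.mul_sum, ← Finset.sum_mul]
    simp [ind]
  rw [this, ← Finset.sum_sub_distrib]
  apply Finset.sum_congr rfl
  intro b _
  rw [← Finset.sum_sub_distrib]
  apply Finset.sum_congr rfl
  intro c _
  by_cases hab : a = b
  · subst hab
    simp [p3, p2, ind, h.self]
  · simp [p3, p2, ind, hab]

theorem bil_expand (x y : V) (g : V → V → ℝ) :
    ∑ a, ∑ b, g (sg x y a) (sg x y b)
      = ∑ a, ∑ b, g a b + (∑ a, (g a y - g a x)) + (∑ b, (g y b - g x b))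
        + (g y y - g y x - g x y + g x x) := by
  have e1 : ∀ a, ∑ b, g a (sg x y b) = ∑ b, g a b + g a y - g a x := fun a => sum_sg x y (g a)
  have e2 := sum_sg x y (fun a => ∑ b, g a b + g a y - g a x)
  simp_rw [e1]
  simp only [Finset.sum_add_distrib, Finset.sum_sub_distrib] at e2 ⊢
  rw [e2]
  ring

theorem tri_expand (x y : V) (g : V → V → V → ℝ) :
    ∑ a, ∑ b, ∑ c, g (sg x y a) (sg x y b) (sg x y c)
      + ∑ a, ∑ b, ∑ c, g (sg y x a) (sg y x b) (sg y x c)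
      = 2 * ∑ a, ∑ b, ∑ c, g a b c
       + 2 * ∑ c, (g y y c - g y x c - g x y c + g x x c)
       + 2 * ∑ c, (g y c y - g y c x - g x c y + g x c x)
       + 2 * ∑ c, (g c y y - g c y x - g c x y + g c x x) := by
  have e1 : ∀ x y a b, ∑ c, g a b (sg x y c) = ∑ c, g a b c + g a b y - g a b x :=
    fun x y a b => sum_sg x y (g a b)
  have e2 := bil_expand x y (fun a b => ∑ c, g a b c + g a b y - g a b x)
  have e3 := bil_expand y x (fun a b => ∑ c, g a b c + g a b x - g a b y)
  simp_rw [e1]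
  rw [e2, e3]
  simp only [Finset.sum_add_distrib, Finset.sum_sub_distrib]
  ring

theorem conv_sum {d : V → V → ZMod 3} (h : Asym d) {x y : V} (hxy : d x y = 0) :
    2 * p d ≤ p (conv d x y) + p (conv d y x) := by
  rw [p_eq h, p_eq (h.conv x y), p_eq (h.conv y x)]
  have hyx : d y x = 0 := by rw [h x y, hxy]; rfl
  have hxx := h.self x
  have hyy := h.self y
  have c3 : ∀ x y a b c, p3 (conv d x y) a b c = p3 d (sg x y a) (sg x y b) (sg x y c) :=
    fun _ _ _ _ _ => rfl
  have c2 : ∀ x y a c, p2 (conv d x y) a c = p2 d (sg x y a) (sg x y c) :=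
    fun _ _ _ _ => rfl
  simp_rw [c3, c2]
  have t := tri_expand x y (p3 d)
  have b1 := bil_expand x y (p2 d)
  have b2 := bil_expand y x (p2 d)
  rw [b1, b2]
  simp only [Finset.sum_sub_distrib]
  have z1 : ∑ c, (p3 d y c y - p3 d y c x - p3 d x c y + p3 d x c x) = 0 := by
    apply Finset.sum_eq_zero
    intro c _
    simp [p3, ind, hxy, hyx, hxx, hyy]
  have z2 : ∑ c, (p3 d c y y - p3 d c y x - p3 d c x y + p3 d c x x) = 0 := by
    apply Finset.sum_eq_zero
    intro c _
    simp [p3, ind, hxy, hyx, hxx, hyy]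
  have z3 : 0 ≤ ∑ c, (p3 d y y c - p3 d y x c - p3 d x y c + p3 d x x c) := by
    apply Finset.sum_nonneg
    intro c _
    simp only [p3, ind, hxy, hyx, hxx, hyy]
    by_cases h1 : d x c = -1 <;> by_cases h2 : d y c = -1 <;> simp [h1, h2]
  have z4 : p2 d y y - p2 d y x - p2 d x y + p2 d x x = 0 := by
    simp [p2, ind, hxy, hyx, hxx, hyy]
  linarith

/-- number of twin pairs -/
noncomputable def tw (d : V → V → ZMod 3) : ℝ := ∑ u, ∑ v, ind (d u = d v)

theorem tw_conv {d : V → V → ZMod 3} {x y : V} (hne : d x ≠ d y)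
    (hcl : ∑ v, ind (d x = d v) ≤ ∑ v, ind (d y = d v)) : tw d < tw (conv d x y) := by
  have b := bil_expand x y (fun u v => ind (d u = d v))
  have le : ∑ a, ∑ b, ind (d (sg x y a) = d (sg x y b)) ≤ tw (conv d x y) := by
    unfold tw
    apply Finset.sum_le_sum; intro a _
    apply Finset.sum_le_sum; intro b _
    apply ind_mono
    intro h
    funext w
    simp only [conv, h]
  have s1 : ∀ z, ∑ a, ind (d a = d z) = ∑ a, ind (d z = d a) := fun z =>
    Finset.sum_congr rfl fun a _ => ind_congr eq_comm
  simp only [Finset.sum_sub_distrib, s1] at b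
  rw [ind_true trivial, ind_false hne,
    ind_false hne.symm] at b
  unfold tw at le ⊢
  linarith

theorem zykov (D : (V → V → ZMod 3) → Prop) (hD : ∀ d, D d → Asym d)
    (hc : ∀ d x y, D d → d x y = 0 → p d ≤ p (conv d x y) → D (conv d x y))
    (d : V → V → ZMod 3) (hd : D d) :
    ∃ e, D e ∧ p d ≤ p e ∧ ∀ x y, e x y = 0 → e x = e y := by
  obtain ⟨e, he, hmax⟩ := Finset.exists_max_image (univ.filter D) p ⟨d, by simpa using hd⟩
  obtain ⟨g, hg, hgmax⟩ := Finset.exists_max_image (univ.filter fun g => D g ∧ p g = p e) tw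
    ⟨e, by simpa using he⟩
  simp only [mem_filter, mem_univ, true_and] at he hmax hg hgmax
  refine ⟨g, hg.1, by rw [hg.2]; exact hmax d hd, ?_⟩
  intro x y hxy
  by_contra hne
  have as := hD g hg.1
  have hyx : g y x = 0 := by rw [as x y, hxy]; rfl
  have s := conv_sum as hxy
  have u1 : p (conv g x y) = p e := by
    by_cases h : p g ≤ p (conv g x y)
    · exact le_antisymm (hmax _ (hc _ _ _ hg.1 hxy h)) (hg.2 ▸ h)
    · push Not at h
      have h2 : p g ≤ p (conv g y x) := by linarith
      have := hmax _ (hc _ _ _ hg.1 hyx h2)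
      linarith
  have u2 : p (conv g y x) = p e := by
    have h2 : p g ≤ p (conv g y x) := by
      by_contra h
      push Not at h
      linarith
    exact le_antisymm (hmax _ (hc _ _ _ hg.1 hyx h2)) (hg.2 ▸ h2)
  rcases le_total (∑ v, ind (g x = g v)) (∑ v, ind (g y = g v)) with hle | hle
  · have := tw_conv hne hle
    have := hgmax (conv g x y) ⟨hc _ _ _ hg.1 hxy (by rw [u1, hg.2]), u1⟩
    linarith
  · have := tw_conv (Ne.symm hne) hle
    have := hgmax (conv g y x) ⟨hc _ _ _ hg.1 hyx (by rw [u2, hg.2]), u2⟩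
    linarith

end PC

namespace PC
open Classical Finset

variable {V : Type} [Fintype V]

theorem sum3_mul (u v w : V → ℝ) :
    ∑ a, ∑ b, ∑ c, u a * v b * w c = (∑ a, u a) * (∑ b, v b) * (∑ c, w c) := by
  simp_rw [← Finset.mul_sum, ← Finset.sum_mul, ← Finset.mul_sum, ← Finset.sum_mul]

theorem sum3_le {F G : V → V → V → ℝ} (h : ∀ a b c, F a b c ≤ G a b c) :
    ∑ a, ∑ b, ∑ c, F a b c ≤ ∑ a, ∑ b, ∑ c, G a b c :=
  Finset.sum_le_sum fun a _ => Finset.sum_le_sum fun b _ => Finset.sum_le_sum fun c _ => h a b c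

theorem sum2_le {F G : V → V → ℝ} (h : ∀ a b, F a b ≤ G a b) :
    ∑ a, ∑ b, F a b ≤ ∑ a, ∑ b, G a b :=
  Finset.sum_le_sum fun a _ => Finset.sum_le_sum fun b _ => h a b

theorem sum_sub3 (B : V → Prop) [Fintype {a // B a}] (F : V → V → V → ℝ) :
    ∑ a : {a // B a}, ∑ b : {a // B a}, ∑ c : {a // B a}, F a.1 b.1 c.1
      = ∑ a, ∑ b, ∑ c, ind (B a) * (ind (B b) * (ind (B c) * F a b c)) := by
  have e0 : ∀ a b, ∑ c : {a // B a}, F a b c.1 = ∑ c, ind (B c) * F a b c :=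
    fun a b => sum_sub B (fun c => F a b c)
  simp_rw [e0]
  have : ∀ a, ∑ b : {a // B a}, ∑ c, ind (B c) * F a b.1 c
    = ∑ b, ind (B b) * ∑ c, ind (B c) * F a b c :=
    fun a => sum_sub B (fun b => ∑ c, ind (B c) * F a b c)
  simp_rw [this]
  rw [sum_sub B (fun a => ∑ b, ind (B b) * ∑ c, ind (B c) * F a b c)]
  simp_rw [Finset.mul_sum]

theorem sym_struct [Nonempty V] {d : V → V → ZMod 3} (h : Asym d)
    (hb : ∀ x y, d x y = 0 → d x = d y) :
    ∃ (y : V) (k μ : ℝ), k = ∑ u, ind (d u = d y) ∧ μ = ∑ v, ind (d y v = 1) ∧ 1 ≤ k ∧ 0 ≤ μ ∧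
      k + μ ≤ Fintype.card V ∧
      (∀ a, ∑ b, ind (d b = d a) ≤ k) ∧
      p d ≤ p (fun a b : {a // ¬ d a = d y} => d a.1 b.1)
        + k * k * (Fintype.card V - k - μ) + k * μ * min k μ := by
  obtain ⟨y, -, hy⟩ := Finset.exists_max_image (univ : Finset V)
    (fun a => ∑ b, ind (d b = d a)) univ_nonempty
  set k := ∑ u, ind (d u = d y) with hk
  set μ := ∑ v, ind (d y v = 1) with hμ
  have eqz : ∀ a b, d a = d b → d a b = 0 := fun a b e => by rw [e]; exact h.self b
  have hout : ∑ v, ind (d y v = -1) = Fintype.card V - k - μ := by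
    have : ∑ v, ind (d y v = -1) + k + μ = ∑ v : V, (1 : ℝ) := by
      rw [hk, hμ, ← Finset.sum_add_distrib, ← Finset.sum_add_distrib]
      apply Finset.sum_congr rfl
      intro v _
      have e : ind (d v = d y) = ind (d y v = 0) :=
        ind_congr ⟨fun e => eqz _ _ e.symm, fun e => (hb _ _ e).symm⟩
      rw [e]
      generalize d y v = x
      rcases zm3 x with rfl | rfl | rfl <;> simp [ind, zm01, zm02, zm12, zm21]
    simp at this
    linarith
  have hout0 : 0 ≤ ∑ v, ind (d y v = -1) := Finset.sum_nonneg fun _ _ => ind_nonneg _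
  refine ⟨y, k, μ, rfl, rfl, ?_, Finset.sum_nonneg fun _ _ => ind_nonneg _, by linarith,
    fun a => hy a (mem_univ a), ?_⟩
  · have := Finset.single_le_sum (f := fun u => ind (d u = d y)) (s := univ)
      (fun _ _ => ind_nonneg _) (mem_univ y)
    simpa [ind_true] using this
  have hpB : p (fun a b : {a // ¬ d a = d y} => d a.1 b.1) =
      ∑ a, ∑ b, ∑ c, ind (¬ d a = d y) * (ind (¬ d b = d y) * (ind (¬ d c = d y) *
        ind (a ≠ b ∧ d a b = 0 ∧ d a c = -1 ∧ d b c = -1))) := by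
    rw [← sum_sub3 (fun a => ¬ d a = d y)
      (fun a b c => ind (a ≠ b ∧ d a b = 0 ∧ d a c = -1 ∧ d b c = -1))]
    unfold p
    simp only [ne_eq, Subtype.ext_iff]
  have main : p d ≤ p (fun a b : {a // ¬ d a = d y} => d a.1 b.1)
      + ∑ a, ∑ b, ∑ c, ind (d a = d y) * ind (d b = d y) * ind (d y c = -1)
      + ∑ a, ∑ b, ∑ c, ind (d y a = 1) * (ind (d b = d a) * ind (d y b = 1)) * ind (d c = d y) := by
    rw [hpB]
    simp_rw [← Finset.sum_add_distrib]
    unfold p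
    apply sum3_le
    intro a b c
    by_cases hj : (a ≠ b ∧ d a b = 0 ∧ d a c = -1 ∧ d b c = -1)
    · obtain ⟨h1, h2, h3, h4⟩ := hj
      have hab := hb a b h2
      simp only [← ind_and]
      have key : (¬d a = d y ∧ ¬d b = d y ∧ ¬d c = d y ∧ a ≠ b ∧ d a b = 0 ∧ d a c = -1 ∧ d b c = -1)
        ∨ ((d a = d y ∧ d b = d y) ∧ d y c = -1) ∨
          ((d y a = 1 ∧ d b = d a ∧ d y b = 1) ∧ d c = d y) := by
        by_cases hay : d a = d y
        · right; left
          exact ⟨⟨hay, hab ▸ hay⟩, by rw [← hay]; exact h3⟩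
        · by_cases hcy : d c = d y
          · right; right
            have q : ∀ a, d a c = -1 → d y a = 1 := by
              intro a ha
              rw [← hcy, h a c, ha]; decide
            exact ⟨⟨q a h3, hab.symm, q b h4⟩, hcy⟩
          · left
            exact ⟨hay, hab ▸ hay, hcy, h1, h2, h3, h4⟩
      have n1 := ind_nonneg (¬d a = d y ∧ ¬d b = d y ∧ ¬d c = d y ∧ a ≠ b ∧ d a b = 0 ∧ d a c = -1 ∧ d b c = -1)
      have n2 := ind_nonneg ((d a = d y ∧ d b = d y) ∧ d y c = -1)
      have n3 := ind_nonneg ((d y a = 1 ∧ d b = d a ∧ d y b = 1) ∧ d c = d y)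
      have n4 := ind_le_one (a ≠ b ∧ d a b = 0 ∧ d a c = -1 ∧ d b c = -1)
      rcases key with q | q | q
      · rw [ind_true q] at *; linarith
      · rw [ind_true q] at *; linarith
      · rw [ind_true q] at *; linarith
    · rw [ind_false hj]
      simp only [← ind_and]
      have n1 := ind_nonneg (¬d a = d y ∧ ¬d b = d y ∧ ¬d c = d y ∧ a ≠ b ∧ d a b = 0 ∧ d a c = -1 ∧ d b c = -1)
      have n2 := ind_nonneg ((d a = d y ∧ d b = d y) ∧ d y c = -1)
      have n3 := ind_nonneg ((d y a = 1 ∧ d b = d a ∧ d y b = 1) ∧ d c = d y)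
      linarith
  rw [sum3_mul, hout, ← hk] at main
  have t1 : ∑ a, ∑ b, ∑ c, ind (d y a = 1) * (ind (d b = d a) * ind (d y b = 1)) * ind (d c = d y)
      ≤ k * μ * μ := by
    calc _ ≤ ∑ a, ∑ b, ∑ c, ind (d y a = 1) * ind (d y b = 1) * ind (d c = d y) := by
          apply sum3_le
          intro a b c
          simp only [← ind_and]
          apply ind_mono
          tauto
      _ = k * μ * μ := by rw [sum3_mul]; ring
  have t2 : ∑ a, ∑ b, ∑ c, ind (d y a = 1) * (ind (d b = d a) * ind (d y b = 1)) * ind (d c = d y)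
      ≤ k * μ * k := by
    calc _ ≤ ∑ a, ∑ b, ∑ c, ind (d y a = 1) * ind (d b = d a) * ind (d c = d y) := by
          apply sum3_le
          intro a b c
          simp only [← ind_and]
          apply ind_mono
          tauto
      _ = ∑ a, ind (d y a = 1) * (∑ b, ind (d b = d a)) * k := by
          simp_rw [← Finset.mul_sum, ← Finset.sum_mul, ← Finset.mul_sum]; rfl
      _ ≤ ∑ a, ind (d y a = 1) * k * k := by
          apply Finset.sum_le_sum
          intro a ha
          have := hy a ha
          have n0 := ind_nonneg (d y a = 1)
          have hk0 : 0 ≤ k := Finset.sum_nonneg fun _ _ => ind_nonneg _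
          gcongr
      _ = k * μ * k := by
          rw [← Finset.sum_mul, ← Finset.sum_mul]; ring
  rcases le_total k μ with hle | hle
  · rw [min_eq_left hle]; linarith
  · rw [min_eq_right hle]; linarith

theorem ub_aux (N : ℕ) : ∀ (V : Type) [Fintype V], Fintype.card V = N →
    ∀ d : V → V → ZMod 3, Asym d → p d ≤ 2 * A * (N : ℝ) ^ 3 := by
  induction N using Nat.strong_induction_on with
  | _ N ih =>
  intro V _ hN d hd
  rcases isEmpty_or_nonempty V with hV | hV
  · have : p d = 0 := by simp [p]
    have hA := A_lb
    rw [this]; positivity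
  obtain ⟨e, he, hpe, hb⟩ := zykov (fun d : V → V → ZMod 3 => Asym d) (fun _ h => h)
    (fun d x y h _ _ => h.conv x y) d hd
  obtain ⟨y, k, μ, hk, hμ, hk1, hμ0, hkμ, -, hp⟩ := sym_struct he hb
  have hcard : ((Fintype.card {a // ¬ e a = e y} : ℕ) : ℝ) = N - k := by
    rw [card_sub]
    simp_rw [ind_not]
    rw [Finset.sum_sub_distrib, hk]
    simp [hN]
  have hlt : Fintype.card {a // ¬ e a = e y} < N := by
    have : ((Fintype.card {a // ¬ e a = e y} : ℕ) : ℝ) < N := by rw [hcard]; linarith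
    exact_mod_cast this
  have h1 := ih _ hlt {a // ¬ e a = e y} rfl (fun a b => e a.1 b.1) (fun a b => he _ _)
  rw [hcard] at h1
  rw [hN] at hp hkμ
  have h2 := key_identity N k
  have h3 : 0 ≤ (k / 2) * (1 + 2 * A) * (k - x0 * N) ^ 2 := by
    have := A_lb
    positivity
  have h4 : k * μ * min k μ ≤ k * μ * k := by
    apply mul_le_mul_of_nonneg_left (min_le_left _ _) (by positivity)
  nlinarith

theorem ub (d : V → V → ZMod 3) (hd : Asym d) : p d ≤ 2 * A * (Fintype.card V : ℝ) ^ 3 :=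
  ub_aux _ V rfl d hd

end PC

namespace PC
open Classical Finset

/-- A 3-graph together with a colouring consistent with it on good pairs. -/
structure Sys (V : Type) where
  H : V → V → V → Prop
  d : V → V → ZMod 3
  Q0 : V → V → Prop
  Q1 : V → V → Prop
  Q2 : V → V → Prop
  sw : ∀ {a b c}, H a b c → H b a c
  rot : ∀ {a b c}, H a b c → H b c a
  ne : ∀ {a b c}, H a b c → a ≠ b
  as : Asym d
  Q0s : ∀ {a b}, Q0 a b → Q0 b a
  Q1s : ∀ {a b}, Q1 a b → Q1 b a
  Q2s : ∀ {a b}, Q2 a b → Q2 b a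
  Q01 : ∀ {a b}, Q0 a b → Q1 a b
  Q12 : ∀ {a b}, Q1 a b → Q2 a b
  cl0 : ∀ {a b c}, H a b c → Q0 a b → Q1 b c
  cl1 : ∀ {a b c}, H a b c → Q1 a b → Q2 b c
  con : ∀ {a b c}, H a b c → Q2 a b → Q2 b c → d b c = d a b - 1

section
variable {V : Type}
/-- level of a vertex with respect to S -/
noncomputable def bt (S : V → Prop) (u : V) : ZMod 3 := if S u then 0 else 1

theorem bt_pos {S : V → Prop} {u : V} (h : S u) : bt S u = 0 := if_pos h
theorem bt_neg {S : V → Prop} {u : V} (h : ¬ S u) : bt S u = 1 := if_neg h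

def right (Q : V → V → Prop) (d : V → V → ZMod 3) (S : V → Prop) (u v : V) : Prop :=
  Q u v ∧ d u v = bt S u - bt S v

def wrong (Q : V → V → Prop) (d : V → V → ZMod 3) (S : V → Prop) (u v : V) : Prop :=
  u ≠ v ∧ (S u ∨ S v) ∧ ¬ right Q d S u v

theorem right_symm {Q : V → V → Prop} {d : V → V → ZMod 3} {S : V → Prop}
    (hQ : ∀ {a b}, Q a b → Q b a) (hd : Asym d) {u v : V} (h : right Q d S u v) :
    right Q d S v u :=
  ⟨hQ h.1, by rw [hd u v, h.2]; ring⟩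

theorem wrong_symm {Q : V → V → Prop} {d : V → V → ZMod 3} {S : V → Prop}
    (hQ : ∀ {a b}, Q a b → Q b a) (hd : Asym d) {u v : V} (h : wrong Q d S u v) :
    wrong Q d S v u :=
  ⟨h.1.symm, h.2.1.symm, fun g => h.2.2 (right_symm hQ hd g)⟩

namespace Sys
variable (M : Sys V) {S : V → Prop}

theorem zalg1 : ∀ x y a b c : ZMod 3, x = a - b → y = b - c → y = x - 1 → a + b + c = 1 := by
  decide
theorem zalg2 : ∀ x y a b c : ZMod 3, x = a - b → y = x - 1 → a + b + c = 1 → y = b - c := by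
  decide

theorem two_right {a b c : V} (h : M.H a b c) (h1 : right M.Q2 M.d S a b)
    (h2 : right M.Q2 M.d S b c) : bt S a + bt S b + bt S c = 1 :=
  zalg1 _ _ _ _ _ h1.2 h2.2 (M.con h h1.1 h2.1)

theorem r01 {a b} (h : right M.Q0 M.d S a b) : right M.Q1 M.d S a b := ⟨M.Q01 h.1, h.2⟩
theorem r12 {a b} (h : right M.Q1 M.d S a b) : right M.Q2 M.d S a b := ⟨M.Q12 h.1, h.2⟩

theorem step0 {a b c : V} (h : M.H a b c) (hs : bt S a + bt S b + bt S c = 1)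
    (h1 : right M.Q0 M.d S a b) : right M.Q1 M.d S b c :=
  ⟨M.cl0 h h1.1, zalg2 _ _ _ _ _ h1.2
    (M.con h (M.Q12 (M.Q01 h1.1)) (M.Q12 (M.cl0 h h1.1))) hs⟩

theorem step1 {a b c : V} (h : M.H a b c) (hs : bt S a + bt S b + bt S c = 1)
    (h1 : right M.Q1 M.d S a b) : right M.Q2 M.d S b c :=
  ⟨M.cl1 h h1.1, zalg2 _ _ _ _ _ h1.2 (M.con h (M.Q12 h1.1) (M.cl1 h h1.1)) hs⟩

theorem s1 {a b} (h : right M.Q1 M.d S a b) : right M.Q1 M.d S b a := right_symm M.Q1s M.as h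
theorem s0 {a b} (h : right M.Q0 M.d S a b) : right M.Q0 M.d S b a := right_symm M.Q0s M.as h
theorem s2 {a b} (h : right M.Q2 M.d S a b) : right M.Q2 M.d S b a := right_symm M.Q2s M.as h

theorem LB {z u v : V} (hz : ¬ S z) (hu : S u) (hv : S v) (h : M.H z u v)
    (hr : right M.Q0 M.d S u v) : right M.Q1 M.d S u z ∧ right M.Q1 M.d S v z := by
  have e : bt S u + bt S v + bt S z = 1 := by rw [bt_pos hu, bt_pos hv, bt_neg hz]; decide
  have e' : bt S v + bt S u + bt S z = 1 := by rw [bt_pos hu, bt_pos hv, bt_neg hz]; decide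
  exact ⟨M.step0 (M.sw (M.rot h)) e' (M.s0 hr), M.step0 (M.rot h) e hr⟩

theorem LB2 {z u v : V} (hz : ¬ S z) (hu : S u) (hv : ¬ S v) (h : M.H z u v)
    (hr : right M.Q0 M.d S u v) : ¬ right M.Q1 M.d S u z := by
  intro h1
  have := M.two_right h (M.r12 (M.s1 h1)) (M.r12 (M.r01 hr))
  rw [bt_pos hu, bt_neg hv, bt_neg hz] at this
  revert this; decide

theorem LS1 {z u v : V} (hu : S u) (hv : S v) (h : M.H z u v)
    (hr : right M.Q0 M.d S u v) : M.Q1 u z ∧ M.d u z = -1 := by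
  have q1 : M.Q1 u z := M.cl0 (M.sw (M.rot h)) (M.Q0s hr.1)
  refine ⟨q1, ?_⟩
  have := M.con (M.sw (M.rot h)) (M.Q2s (M.Q12 (M.Q01 hr.1))) (M.Q12 q1)
  rw [this, (M.s0 hr).2, bt_pos hu, bt_pos hv]; decide

theorem LS2 {z u v : V} (hz : S z) (hu : S u) (hv : ¬ S v) (h : M.H z u v)
    (hr : right M.Q0 M.d S u v) : right M.Q1 M.d S z u ∧ right M.Q1 M.d S z v := by
  have e : bt S u + bt S v + bt S z = 1 := by rw [bt_pos hu, bt_neg hv, bt_pos hz]; decide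
  have e' : bt S v + bt S u + bt S z = 1 := by rw [bt_pos hu, bt_neg hv, bt_pos hz]; decide
  exact ⟨M.s1 (M.step0 (M.sw (M.rot h)) e' (M.s0 hr)), M.s1 (M.step0 (M.rot h) e hr)⟩

theorem LS3 {z u v : V} (hz : S z) (hu : ¬ S u) (hv : ¬ S v) (h : M.H z u v)
    (h1 : right M.Q2 M.d S z u) (h2 : right M.Q2 M.d S z v) : False := by
  have := M.two_right (M.sw h) (M.s2 h1) h2
  rw [bt_pos hz, bt_neg hv, bt_neg hu] at this
  revert this; decide

/-- two right pairs inside S are impossible -/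
theorem LSSS {a b c : V} (ha : S a) (hb : S b) (hc : S c) (h : M.H a b c)
    (h1 : right M.Q2 M.d S a b) (h2 : right M.Q2 M.d S b c) : False := by
  have := M.two_right h h1 h2
  rw [bt_pos ha, bt_pos hb, bt_pos hc] at this
  revert this; decide

theorem LSSB {s t b : V} (hs : S s) (ht : S t) (hb : ¬ S b) (h : M.H s t b) :
    (right M.Q1 M.d S s t → right M.Q2 M.d S s b ∧ right M.Q2 M.d S t b) ∧
    (right M.Q1 M.d S s b → right M.Q2 M.d S s t) := by
  have e : bt S s + bt S t + bt S b = 1 := by rw [bt_pos hs, bt_pos ht, bt_neg hb]; decide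
  have e' : bt S t + bt S s + bt S b = 1 := by rw [bt_pos hs, bt_pos ht, bt_neg hb]; decide
  have e2 : bt S b + bt S s + bt S t = 1 := by rw [bt_pos hs, bt_pos ht, bt_neg hb]; decide
  refine ⟨fun r => ⟨M.step1 (M.sw h) e' (M.s1 r), M.step1 h e r⟩, fun r => ?_⟩
  exact M.step1 (M.rot (M.rot h)) e2 (M.s1 r)

end Sys
end

variable {V : Type} [Fintype V]

/-- number of wrong ordered pairs -/
noncomputable def W (Q : V → V → Prop) (d : V → V → ZMod 3) (S : V → Prop) : ℝ :=
  ∑ u, ∑ v, ind (wrong Q d S u v)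

noncomputable def T (H : V → V → V → Prop) : ℝ := ∑ a, ∑ b, ∑ c, ind (H a b c)

/-- size of a vertex set -/
noncomputable def sz (S : V → Prop) : ℝ := ∑ u, ind (S u)

theorem sz_nonneg (S : V → Prop) : 0 ≤ sz S := Finset.sum_nonneg fun _ _ => ind_nonneg _

theorem sz_not (S : V → Prop) : sz (fun u => ¬ S u) = Fintype.card V - sz S := by
  unfold sz
  simp_rw [ind_not, Finset.sum_sub_distrib]
  simp

theorem W_nonneg (Q : V → V → Prop) (d : V → V → ZMod 3) (S : V → Prop) : 0 ≤ W Q d S :=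
  Finset.sum_nonneg fun _ _ => Finset.sum_nonneg fun _ _ => ind_nonneg _

def Near (η : ℝ) (d : V → V → ZMod 3) : Prop :=
  ∃ S : V → Prop, 0.62 * (Fintype.card V : ℝ) ≤ sz S ∧ sz S ≤ 0.65 * (Fintype.card V : ℝ) ∧
    W (fun _ _ => True) d S ≤ η * (Fintype.card V : ℝ) ^ 2

set_option maxHeartbeats 2000000 in
theorem near_of_sym {d : V → V → ZMod 3} (h : Asym d)
    (hb : ∀ x y, d x y = 0 → d x = d y) {ε : ℝ} (hε0 : 0 ≤ ε) (hε : ε ≤ 0.00001)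
    (hp : (2 * A - ε) * (Fintype.card V : ℝ) ^ 3 ≤ p d) : Near (15 * ε) d := by
  rcases isEmpty_or_nonempty V with hV | hV
  · exact ⟨fun _ => True, by simp [sz], by simp [sz], by simp [W]⟩
  obtain ⟨y, k, μ, hk, hμ, hk1, hμ0, hkμ, hcl, hle⟩ := sym_struct h hb
  set n : ℝ := ((Fintype.card V : ℕ) : ℝ) with hn
  have hA1 := A_lb
  have hA2 := A_ub
  have hx1 := x0_lb
  have hx2 := x0_ub
  have hn1 : 1 ≤ n := by linarith
  have hkl : 0.15 * n ≤ k := by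
    have h1 : p d ≤ n * (n * k) := by
      calc p d ≤ ∑ a, ∑ b, ∑ c : V, ind (d b = d a) := by
            unfold p
            apply sum3_le
            intro a b c
            apply ind_mono
            intro q
            exact (hb a b q.2.1).symm
        _ = ∑ a, (n * ∑ b, ind (d b = d a)) := by
            simp [Finset.mul_sum, hn]
        _ ≤ ∑ a : V, n * k := by
            apply Finset.sum_le_sum
            intro a _
            exact mul_le_mul_of_nonneg_left (hcl a) (by linarith)
        _ = n * (n * k) := by simp [hn]
    have h2 : 0.15 * n ^ 3 ≤ n * (n * k) := by
      refine le_trans ?_ (hp.trans h1)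
      apply mul_le_mul_of_nonneg_right _ (by positivity)
      linarith
    have h3 : n ^ 2 * (0.15 * n) ≤ n ^ 2 * k := by nlinarith
    exact le_of_mul_le_mul_left h3 (by positivity)
  have hcard : ((Fintype.card {a // ¬ d a = d y} : ℕ) : ℝ) = n - k := by
    rw [card_sub]
    simp_rw [ind_not]
    rw [Finset.sum_sub_distrib, hk]
    simp [hn]
  have hB := ub (fun a b : {a // ¬ d a = d y} => d a.1 b.1) (fun a b => h _ _)
  rw [hcard] at hB
  have hid := key_identity n k
  have hmain : k * (1 + 2 * A) * (k - x0 * n) ^ 2 + k * μ * (k - min k μ) ≤ ε * n ^ 3 := by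
    nlinarith
  have hmin : 0 ≤ k - min k μ := by linarith [min_le_left k μ]
  have hsq : (k - x0 * n) ^ 2 ≤ (0.01 * n) ^ 2 := by
    have h1 : 0 ≤ k * μ * (k - min k μ) := by positivity
    have h2 : 0.15 * n * (k - x0 * n) ^ 2 ≤ k * (1 + 2 * A) * (k - x0 * n) ^ 2 := by
      apply mul_le_mul_of_nonneg_right _ (sq_nonneg _)
      nlinarith
    have h3 : n * (0.15 * (k - x0 * n) ^ 2) ≤ n * (ε * n ^ 2) := by nlinarith
    have h4 := le_of_mul_le_mul_left h3 (by linarith)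
    have h5 : ε * n ^ 2 ≤ 0.00001 * n ^ 2 := by gcongr
    nlinarith
  have habs := abs_le_of_sq_le_sq' hsq (by positivity)
  have hkl2 : 0.62 * n ≤ k := by nlinarith
  have hku2 : k ≤ 0.65 * n := by nlinarith
  have hμk : min k μ ≤ 0.38 * n := by linarith [min_le_right k μ]
  have hμs : μ ≤ 7 * ε * n := by
    have h1 : 0 ≤ k * (1 + 2 * A) * (k - x0 * n) ^ 2 := by positivity
    have h2 : (0.62 * n) * μ * (0.24 * n) ≤ k * μ * (k - min k μ) := by
      gcongr; linarith
    have h3 : n ^ 2 * (0.1488 * μ) ≤ n ^ 2 * (ε * n) := by nlinarith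
    have h4 := le_of_mul_le_mul_left h3 (by positivity)
    nlinarith
  refine ⟨fun u => d u = d y, by rw [sz, ← hk]; exact hkl2, by rw [sz, ← hk]; exact hku2, ?_⟩
  have eqz : ∀ a b, d a = d b → d a b = 0 := fun a b e => by rw [e]; exact h.self b
  have hW : W (fun _ _ => True) d (fun u => d u = d y) ≤ 2 * k * μ := by
    calc W (fun _ _ => True) d (fun u => d u = d y)
        ≤ ∑ u, ∑ v, (ind (d u = d y) * ind (d y v = 1) + ind (d y u = 1) * ind (d v = d y)) := by
          unfold W
          apply sum2_le
          intro u v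
          simp only [← ind_and]
          by_cases hw : wrong (fun _ _ => True) d (fun u => d u = d y) u v
          · obtain ⟨h1, h2, h3⟩ := hw
            have key : (d u = d y ∧ d y v = 1) ∨ (d y u = 1 ∧ d v = d y) := by
              by_cases hu : d u = d y
              · left
                refine ⟨hu, ?_⟩
                by_cases hv : d v = d y
                · exfalso; apply h3
                  refine ⟨trivial, ?_⟩
                  rw [bt_pos (S := fun u => d u = d y) hu, bt_pos (S := fun u => d u = d y) hv, eqz u v (hu.trans hv.symm)]; decide
                · rcases zm3 (d y v) with q | q | q
                  · exact absurd (hb _ _ q).symm hv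
                  · exact q
                  · exfalso; apply h3
                    refine ⟨trivial, ?_⟩
                    rw [bt_pos (S := fun u => d u = d y) hu, bt_neg (S := fun u => d u = d y) hv, hu, q]; decide
              · right
                have hv : d v = d y := h2.resolve_left hu
                refine ⟨?_, hv⟩
                rcases zm3 (d y u) with q | q | q
                · exact absurd (hb _ _ q).symm hu
                · exact q
                · exfalso; apply h3
                  refine ⟨trivial, ?_⟩
                  rw [bt_neg (S := fun u => d u = d y) hu, bt_pos (S := fun u => d u = d y) hv, h v u, hv, q]; decide
            have n1 := ind_nonneg (d u = d y ∧ d y v = 1)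
            have n2 := ind_nonneg (d y u = 1 ∧ d v = d y)
            have n3 := ind_le_one (wrong (fun _ _ => True) d (fun u => d u = d y) u v)
            rcases key with q | q <;> rw [ind_true q] at * <;> linarith
          · rw [ind_false hw]
            have n1 := ind_nonneg (d u = d y ∧ d y v = 1)
            have n2 := ind_nonneg (d y u = 1 ∧ d v = d y)
            linarith
      _ = 2 * k * μ := by
          simp_rw [Finset.sum_add_distrib, ← Finset.mul_sum, ← Finset.sum_mul]
          rw [← hk, ← hμ]; ring
  have : k * μ ≤ n * (7 * ε * n) := by
    gcongr; linarith
  have h7 : 0 ≤ ε * n ^ 2 := by positivity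
  nlinarith

end PC

namespace PC
open Classical Finset

theorem ind_or (P Q : Prop) : ind (P ∨ Q) ≤ ind P + ind Q := by
  by_cases hp : P <;> by_cases hq : Q <;> simp [ind, hp, hq]

variable {V : Type} [Fintype V]

theorem sum3_rot (F : V → V → V → ℝ) :
    ∑ a, ∑ b, ∑ c, F b c a = ∑ a, ∑ b, ∑ c, F a b c := by
  rw [Finset.sum_comm]
  apply Finset.sum_congr rfl; intro b _
  rw [Finset.sum_comm]

theorem sum3_swap (F : V → V → V → ℝ) :
    ∑ a, ∑ b, ∑ c, F a c b = ∑ a, ∑ b, ∑ c, F a b c := by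
  apply Finset.sum_congr rfl; intro b _
  rw [Finset.sum_comm]

theorem sum3_deg (F : V → V → ℝ) (G : V → V → V → ℝ) (R : ℝ) (hF : ∀ a b, 0 ≤ F a b)
    (hG : ∀ a b, F a b ≠ 0 → ∑ c, G a b c ≤ R) :
    ∑ a, ∑ b, ∑ c, F a b * G a b c ≤ (∑ a, ∑ b, F a b) * R := by
  rw [Finset.sum_mul]
  apply Finset.sum_le_sum; intro a _
  rw [Finset.sum_mul]
  apply Finset.sum_le_sum; intro b _
  rw [← Finset.mul_sum]
  by_cases h : F a b = 0
  · simp [h]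
  · exact mul_le_mul_of_nonneg_left (hG a b h) (hF a b)

theorem sum_one_sub (S : V → Prop) : ∑ u, (1 - ind (S u)) = Fintype.card V - sz S := by
  rw [← sz_not]; unfold sz; simp_rw [ind_not]

namespace Sys
variable (M : Sys V) (S : V → Prop)

theorem DB {z : V} (hz : ¬ S z) (k a n : ℝ) (hk : k = sz S) (hn : n = Fintype.card V)
    (ha : a = sz (fun u => S u ∧ right M.Q1 M.d S u z)) :
    ∑ u, ∑ v, ind (M.H z u v ∧ (S u ∨ S v)) ≤
      W M.Q0 M.d S + a ^ 2 + 2 * (k - a) * (n - k) := by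
  have pt : ∀ u v, ind (M.H z u v ∧ (S u ∨ S v)) ≤ ind (wrong M.Q0 M.d S u v)
      + ind (S u ∧ right M.Q1 M.d S u z) * ind (S v ∧ right M.Q1 M.d S v z)
      + (ind (S u) - ind (S u ∧ right M.Q1 M.d S u z)) * (1 - ind (S v))
      + (1 - ind (S u)) * (ind (S v) - ind (S v ∧ right M.Q1 M.d S v z)) := by
    intro u v
    have n0 := ind_nonneg (wrong M.Q0 M.d S u v)
    have n1 := ind_nonneg (S u ∧ right M.Q1 M.d S u z)
    have n2 := ind_nonneg (S v ∧ right M.Q1 M.d S v z)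
    have n3 : 0 ≤ ind (S u) - ind (S u ∧ right M.Q1 M.d S u z) :=
      sub_nonneg.2 (ind_mono fun h => h.1)
    have n4 : 0 ≤ ind (S v) - ind (S v ∧ right M.Q1 M.d S v z) :=
      sub_nonneg.2 (ind_mono fun h => h.1)
    have n5 : 0 ≤ 1 - ind (S u) := sub_nonneg.2 (ind_le_one _)
    have n6 : 0 ≤ 1 - ind (S v) := sub_nonneg.2 (ind_le_one _)
    have m1 := mul_nonneg n1 n2
    have m2 := mul_nonneg n3 n6
    have m3 := mul_nonneg n5 n4
    by_cases hH : M.H z u v ∧ (S u ∨ S v)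
    · rw [ind_true hH]
      by_cases hw : wrong M.Q0 M.d S u v
      · rw [ind_true hw]; linarith
      · have hr : right M.Q0 M.d S u v := by
          by_contra hr
          exact hw ⟨M.ne (M.rot hH.1), hH.2, hr⟩
        by_cases su : S u
        · by_cases sv : S v
          · have := M.LB hz su sv hH.1 hr
            rw [ind_true (⟨su, this.1⟩ : S u ∧ right M.Q1 M.d S u z),
              ind_true (⟨sv, this.2⟩ : S v ∧ right M.Q1 M.d S v z), ind_true su, ind_true sv]
            linarith
          · have := M.LB2 hz su sv hH.1 hr
            rw [ind_false (fun h : S u ∧ right M.Q1 M.d S u z => this h.2),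
              ind_false (fun h : S v ∧ right M.Q1 M.d S v z => sv h.1), ind_true su, ind_false sv]
            linarith
        · have sv := hH.2.resolve_left su
          have := M.LB2 hz sv su (M.rot (M.sw hH.1)) (M.s0 hr)
          rw [ind_false (fun h : S v ∧ right M.Q1 M.d S v z => this h.2),
            ind_false (fun h : S u ∧ right M.Q1 M.d S u z => su h.1), ind_true sv, ind_false su]
          linarith
    · rw [ind_false hH]; linarith
  refine (sum2_le pt).trans ?_
  simp_rw [Finset.sum_add_distrib, ← Finset.mul_sum, ← Finset.sum_mul, Finset.sum_sub_distrib]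
  rw [hk, ha, hn]
  have e1 := sum_one_sub S
  rw [Finset.sum_sub_distrib] at e1
  rw [e1]
  unfold W sz
  apply le_of_eq; ring

theorem DS {z : V} (hz : S z) (k a t q n : ℝ) (hk : k = sz S) (hn : n = Fintype.card V)
    (ha : a = sz (fun u => S u ∧ M.Q1 u z ∧ M.d u z = -1))
    (ht : t = sz (fun u => S u ∧ right M.Q1 M.d S z u))
    (hq : q = sz (fun u => ¬ S u ∧ right M.Q1 M.d S z u)) :
    ∑ u, ∑ v, ind (M.H z u v) ≤
      W M.Q0 M.d S + a ^ 2 + 2 * t * q + ((n - k) ^ 2 - q ^ 2) := by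
  have pt : ∀ u v, ind (M.H z u v) ≤ ind (wrong M.Q0 M.d S u v)
      + ind (S u ∧ M.Q1 u z ∧ M.d u z = -1) * ind (S v ∧ M.Q1 v z ∧ M.d v z = -1)
      + ind (S u ∧ right M.Q1 M.d S z u) * ind (¬ S v ∧ right M.Q1 M.d S z v)
      + ind (¬ S u ∧ right M.Q1 M.d S z u) * ind (S v ∧ right M.Q1 M.d S z v)
      + ((1 - ind (S u)) * (1 - ind (S v)) -
        ind (¬ S u ∧ right M.Q1 M.d S z u) * ind (¬ S v ∧ right M.Q1 M.d S z v)) := by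
    intro u v
    have n0 := ind_nonneg (wrong M.Q0 M.d S u v)
    have m1 := mul_nonneg (ind_nonneg (S u ∧ M.Q1 u z ∧ M.d u z = -1))
      (ind_nonneg (S v ∧ M.Q1 v z ∧ M.d v z = -1))
    have m2 := mul_nonneg (ind_nonneg (S u ∧ right M.Q1 M.d S z u))
      (ind_nonneg (¬ S v ∧ right M.Q1 M.d S z v))
    have m3 := mul_nonneg (ind_nonneg (¬ S u ∧ right M.Q1 M.d S z u))
      (ind_nonneg (S v ∧ right M.Q1 M.d S z v))
    have m4 : 0 ≤ ((1 - ind (S u)) * (1 - ind (S v)) -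
        ind (¬ S u ∧ right M.Q1 M.d S z u) * ind (¬ S v ∧ right M.Q1 M.d S z v)) := by
      rw [← ind_not, ← ind_not, ← ind_and, ← ind_and, sub_nonneg]
      exact ind_mono fun h => ⟨h.1.1, h.2.1⟩
    by_cases hH : M.H z u v
    · rw [ind_true hH]
      by_cases hw : wrong M.Q0 M.d S u v
      · rw [ind_true hw]; linarith
      · by_cases hs : S u ∨ S v
        · have hr : right M.Q0 M.d S u v := by
            by_contra hr
            exact hw ⟨M.ne (M.rot hH), hs, hr⟩
          by_cases su : S u
          · by_cases sv : S v
            · have h1 := M.LS1 su sv hH hr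
              have h2 := M.LS1 sv su (M.rot (M.sw hH)) (M.s0 hr)
              rw [ind_true (⟨su, h1⟩ : S u ∧ _), ind_true (⟨sv, h2⟩ : S v ∧ _)] at *
              linarith
            · have h1 := M.LS2 hz su sv hH hr
              rw [ind_true (⟨su, h1.1⟩ : S u ∧ right M.Q1 M.d S z u),
                ind_true (⟨sv, h1.2⟩ : ¬ S v ∧ right M.Q1 M.d S z v)] at *
              linarith
          · have sv := hs.resolve_left su
            have h1 := M.LS2 hz sv su (M.rot (M.sw hH)) (M.s0 hr)
            rw [ind_true (⟨sv, h1.1⟩ : S v ∧ right M.Q1 M.d S z v),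
              ind_true (⟨su, h1.2⟩ : ¬ S u ∧ right M.Q1 M.d S z u)] at *
            linarith
        · push Not at hs
          have : ind (¬ S u ∧ right M.Q1 M.d S z u) * ind (¬ S v ∧ right M.Q1 M.d S z v) = 0 := by
            rw [← ind_and]
            apply ind_false
            rintro ⟨⟨_, h1⟩, ⟨_, h2⟩⟩
            exact M.LS3 hz hs.1 hs.2 hH (M.r12 h1) (M.r12 h2)
          rw [this] at *
          rw [ind_false hs.1, ind_false hs.2] at *
          linarith
    · rw [ind_false hH]; linarith
  refine (sum2_le pt).trans ?_
  simp_rw [Finset.sum_add_distrib]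
  have e1 := sum_one_sub S
  have e2 : ∑ u, ∑ v, ((1 - ind (S u)) * (1 - ind (S v)) -
        ind (¬ S u ∧ right M.Q1 M.d S z u) * ind (¬ S v ∧ right M.Q1 M.d S z v))
      = (n - k) ^ 2 - q ^ 2 := by
    simp_rw [Finset.sum_sub_distrib, ← Finset.mul_sum, ← Finset.sum_mul]
    rw [e1, hk, hn, hq]
    unfold sz; ring
  rw [e2]
  simp_rw [← Finset.mul_sum, ← Finset.sum_mul]
  rw [ha, ht, hq]
  unfold W sz
  apply le_of_eq; ring

end Sys
end PC

namespace PC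
open Classical Finset
set_option linter.unusedSectionVars false
variable {V : Type} [Fintype V]
namespace Sys
variable (M : Sys V) (S : V → Prop)

theorem w21 {u v : V} (h : wrong M.Q2 M.d S u v) : wrong M.Q1 M.d S u v :=
  ⟨h.1, h.2.1, fun r => h.2.2 (M.r12 r)⟩
theorem w10 {u v : V} (h : wrong M.Q1 M.d S u v) : wrong M.Q0 M.d S u v :=
  ⟨h.1, h.2.1, fun r => h.2.2 (M.r01 r)⟩
theorem ws1 (u v : V) : ind (wrong M.Q1 M.d S u v) = ind (wrong M.Q1 M.d S v u) :=
  ind_congr ⟨wrong_symm M.Q1s M.as, wrong_symm M.Q1s M.as⟩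
theorem ws2 (u v : V) : ind (wrong M.Q2 M.d S u v) = ind (wrong M.Q2 M.d S v u) :=
  ind_congr ⟨wrong_symm M.Q2s M.as, wrong_symm M.Q2s M.as⟩

/-- weighted wrong pairs -/
noncomputable def FX (P P' : V → Prop) (u v : V) : ℝ :=
  ind (P u) * ind (P' v) * ind (wrong M.Q2 M.d S u v)

theorem FX_nonneg (P P' : V → Prop) (u v : V) : 0 ≤ M.FX S P P' u v :=
  mul_nonneg (mul_nonneg (ind_nonneg _) (ind_nonneg _)) (ind_nonneg _)

theorem FX_ne {P P' : V → Prop} {u v : V} (h : M.FX S P P' u v ≠ 0) : P u ∧ P' v := by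
  unfold FX at h
  constructor
  · by_contra hp; rw [ind_false hp] at h; simp at h
  · by_contra hp; rw [ind_false hp] at h; simp at h

theorem sum_le_deg {P : V → Prop} {R : ℝ} {u : V} (hu : ∑ v, ind (wrong M.Q1 M.d S u v) ≤ R) :
    ∑ v, ind (P v) * ind (wrong M.Q1 M.d S u v) ≤ R := by
  refine le_trans (Finset.sum_le_sum fun v _ => ?_) hu
  have := ind_nonneg (wrong M.Q1 M.d S u v)
  nlinarith [ind_le_one (P v)]

theorem sum_le_deg' {P : V → Prop} {R : ℝ} {u : V} (hu : ∑ v, ind (wrong M.Q1 M.d S u v) ≤ R) :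
    ∑ v, ind (P v) * ind (wrong M.Q1 M.d S v u) ≤ R := by
  simp_rw [fun v => M.ws1 S v u]
  exact M.sum_le_deg S hu

theorem sum_ne {P : V → Prop} {s : V} (hs : P s) :
    ∑ t, ind (P t) * ind (s ≠ t) = sz P - 1 := by
  have : ∀ t, ind (P t) * ind (s ≠ t) = ind (P t) - ind (s = t) := by
    intro t
    by_cases h : s = t
    · subst h; simp [ind, hs]
    · simp [ind, h]
  simp_rw [this, Finset.sum_sub_distrib]
  unfold sz
  congr 1
  simp [ind]

theorem sum3_deg_eq (F : V → V → ℝ) (G : V → V → V → ℝ) (R : ℝ)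
    (hG : ∀ a b, F a b ≠ 0 → ∑ c, G a b c = R) :
    ∑ a, ∑ b, ∑ c, F a b * G a b c = (∑ a, ∑ b, F a b) * R := by
  rw [Finset.sum_mul]
  apply Finset.sum_congr rfl; intro a _
  rw [Finset.sum_mul]
  apply Finset.sum_congr rfl; intro b _
  rw [← Finset.mul_sum]
  by_cases h : F a b = 0
  · simp [h]
  · rw [hG a b h]

theorem ssb_prop (h X x Y y Z : Prop) (hX : X → x) (hY : Y → y)
    (hh : h → (X → y) ∧ (Y → x) ∧ (Z → x)) :
    ind h ≤ 1 - ind X + ind X * ind y - ind Y + ind Y * ind x - ind Z + ind Z * ind x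
      + ind Z * ind y := by
  by_cases x1 : x
  · rw [ind_true x1]
    by_cases y1 : y
    · rw [ind_true y1]
      linarith [ind_le_one h, ind_nonneg Z]
    · rw [ind_false (fun q => y1 (hY q)), ind_false y1]
      by_cases X1 : X
      · rw [ind_false (fun q => y1 ((hh q).1 X1)), ind_true X1]; linarith
      · rw [ind_false X1]; linarith [ind_le_one h]
  · rw [ind_false (fun q => x1 (hX q)), ind_false x1]
    by_cases Z1 : Z
    · rw [ind_false (fun q => x1 ((hh q).2.2 Z1)), ind_true Z1]
      linarith [ind_mono hY]
    · rw [ind_false Z1]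
      by_cases Y1 : Y
      · rw [ind_false (fun q => x1 ((hh q).2.1 Y1)), ind_true Y1]; linarith
      · rw [ind_false Y1]; linarith [ind_le_one h]

theorem TSSB (S1 B1 : V → Prop) (hS : ∀ u, S1 u → S u) (hB : ∀ u, B1 u → ¬ S u) (R : ℝ)
    (hdS : ∀ u, S1 u → ∑ v, ind (wrong M.Q1 M.d S u v) ≤ R)
    (hdB : ∀ u, B1 u → ∑ v, ind (wrong M.Q1 M.d S u v) ≤ R)
    (k m x y : ℝ) (hk : k = sz S1) (hm : m = sz B1)
    (hx : x = ∑ a, ∑ b, M.FX S S1 S1 a b) (hy : y = ∑ a, ∑ b, M.FX S S1 B1 a b) :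
    ∑ a, ∑ b, ∑ c, ind (S1 a ∧ S1 b ∧ B1 c ∧ M.H a b c) ≤
      k * (k - 1) * m - x * (m - R) - y * (2 * (k - 1) - 3 * R) := by
  have pt : ∀ s t b, ind (S1 s ∧ S1 t ∧ B1 b ∧ M.H s t b) ≤
      (ind (S1 s) * ind (B1 b)) * (ind (S1 t) * ind (s ≠ t))
      - M.FX S S1 S1 s t * ind (B1 b)
      + M.FX S S1 S1 s t * (ind (B1 b) * ind (wrong M.Q1 M.d S s b))
      - M.FX S S1 B1 s b * (ind (S1 t) * ind (s ≠ t))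
      + M.FX S S1 B1 s b * (ind (S1 t) * ind (wrong M.Q1 M.d S s t))
      - M.FX S S1 B1 t b * (ind (S1 s) * ind (t ≠ s))
      + M.FX S S1 B1 t b * (ind (S1 s) * ind (wrong M.Q1 M.d S t s))
      + M.FX S S1 B1 t b * (ind (S1 s) * ind (wrong M.Q1 M.d S s b)) := by
    intro s t b
    unfold FX
    by_cases hs : S1 s
    swap
    · rw [ind_false (fun h => hs h.1)]; simp [ind_false hs]
    by_cases ht : S1 t
    swap
    · rw [ind_false (fun h => ht h.2.1)]; simp [ind_false ht]
    by_cases hb : B1 b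
    swap
    · rw [ind_false (fun h => hb h.2.2.1)]; simp [ind_false hb]
    rw [ind_true hs, ind_true ht, ind_true hb]
    have hsb : s ≠ b := fun e => hB b hb (e ▸ hS s hs)
    have htb : t ≠ b := fun e => hB b hb (e ▸ hS t ht)
    rw [M.ws1 S t s]
    by_cases hst : s = t
    · subst hst
      have h0 : ¬ M.H s s b := fun h => M.ne h rfl
      rw [ind_false (fun h => h0 h.2.2.2), ind_false (fun h : s ≠ s => h rfl)]
      rw [ind_false (fun h : wrong M.Q2 M.d S s s => h.1 rfl),
        ind_false (fun h : wrong M.Q1 M.d S s s => h.1 rfl)]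
      have := mul_nonneg (ind_nonneg (wrong M.Q2 M.d S s b)) (ind_nonneg (wrong M.Q1 M.d S s b))
      linarith
    rw [ind_true hst, ind_true (Ne.symm hst : t ≠ s)]
    have hH : M.H s t b → (wrong M.Q2 M.d S s t → wrong M.Q1 M.d S s b) ∧
        (wrong M.Q2 M.d S s b → wrong M.Q1 M.d S s t) ∧
        (wrong M.Q2 M.d S t b → wrong M.Q1 M.d S s t) := by
      intro h
      obtain ⟨l1, l2⟩ := M.LSSB (hS s hs) (hS t ht) (hB b hb) h
      refine ⟨fun w => ⟨hsb, Or.inl (hS s hs), fun r => w.2.2 (l2 r)⟩,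
        fun w => ⟨hst, Or.inl (hS s hs), fun r => w.2.2 (l1 r).1⟩,
        fun w => ⟨hst, Or.inl (hS s hs), fun r => w.2.2 (l1 r).2⟩⟩
    have e : ind (S1 s ∧ S1 t ∧ B1 b ∧ M.H s t b) = ind (M.H s t b) :=
      ind_congr ⟨fun h => h.2.2.2, fun h => ⟨hs, ht, hb, h⟩⟩
    rw [e]
    have := ssb_prop (M.H s t b) _ _ _ _ _ (M.w21 S (u := s) (v := t)) (M.w21 S (u := s) (v := b)) hH
    linarith
  refine (sum3_le pt).trans ?_
  simp_rw [Finset.sum_add_distrib, Finset.sum_sub_distrib, Finset.sum_add_distrib,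
    Finset.sum_sub_distrib, Finset.sum_add_distrib, Finset.sum_sub_distrib]
  have a1 : ∑ s, ∑ t, ∑ b, (ind (S1 s) * ind (B1 b)) * (ind (S1 t) * ind (s ≠ t))
      = k * (k - 1) * m := by
    rw [← sum3_swap]
    rw [sum3_deg_eq (fun s b => ind (S1 s) * ind (B1 b)) (fun s _ t => ind (S1 t) * ind (s ≠ t))
      (k - 1)]
    · simp_rw [← Finset.mul_sum, ← Finset.sum_mul]
      rw [hk, hm]; unfold sz; ring
    · intro a b h
      have : S1 a := by
        by_contra hp; rw [ind_false hp] at h; simp at h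
      rw [hk]; exact sum_ne this
  have a2 : ∑ s, ∑ t, ∑ b, M.FX S S1 S1 s t * ind (B1 b) = x * m := by
    rw [sum3_deg_eq (M.FX S S1 S1) (fun _ _ b => ind (B1 b)) m (fun _ _ _ => hm.symm), hx]
  have a3 : ∑ s, ∑ t, ∑ b, M.FX S S1 S1 s t * (ind (B1 b) * ind (wrong M.Q1 M.d S s b)) ≤ x * R := by
    rw [hx]
    apply sum3_deg (M.FX S S1 S1) (fun s _ b => ind (B1 b) * ind (wrong M.Q1 M.d S s b)) R
      (M.FX_nonneg S _ _)
    intro a b h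
    exact M.sum_le_deg S (hdS a (M.FX_ne S h).1)
  have a4 : ∑ s, ∑ t, ∑ b, M.FX S S1 B1 s b * (ind (S1 t) * ind (s ≠ t)) = y * (k - 1) := by
    rw [← sum3_swap]
    rw [sum3_deg_eq (M.FX S S1 B1) (fun s _ t => ind (S1 t) * ind (s ≠ t)) (k - 1), hy]
    intro a b h
    rw [hk]; exact sum_ne (M.FX_ne S h).1
  have a5 : ∑ s, ∑ t, ∑ b, M.FX S S1 B1 s b * (ind (S1 t) * ind (wrong M.Q1 M.d S s t)) ≤ y * R := by
    rw [← sum3_swap, hy]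
    apply sum3_deg (M.FX S S1 B1) (fun s _ t => ind (S1 t) * ind (wrong M.Q1 M.d S s t)) R
      (M.FX_nonneg S _ _)
    intro a b h
    exact M.sum_le_deg S (hdS a (M.FX_ne S h).1)
  have a6 : ∑ s, ∑ t, ∑ b, M.FX S S1 B1 t b * (ind (S1 s) * ind (t ≠ s)) = y * (k - 1) := by
    rw [← a4, Finset.sum_comm]
  have a7 : ∑ s, ∑ t, ∑ b, M.FX S S1 B1 t b * (ind (S1 s) * ind (wrong M.Q1 M.d S t s)) ≤ y * R := by
    rw [Finset.sum_comm]; exact a5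
  have a8 : ∑ s, ∑ t, ∑ b, M.FX S S1 B1 t b * (ind (S1 s) * ind (wrong M.Q1 M.d S s b)) ≤ y * R := by
    rw [Finset.sum_comm, ← sum3_swap, hy]
    apply sum3_deg (M.FX S S1 B1) (fun _ b s => ind (S1 s) * ind (wrong M.Q1 M.d S s b)) R
      (M.FX_nonneg S _ _)
    intro a b h
    exact M.sum_le_deg' S (hdB b (M.FX_ne S h).2)
  rw [a1, a2, a4, a6]
  linarith

theorem TSSS (S1 : V → Prop) (hS : ∀ u, S1 u → S u) (R : ℝ)
    (hdS : ∀ u, S1 u → ∑ v, ind (wrong M.Q1 M.d S u v) ≤ R)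
    (x : ℝ) (hx : x = ∑ a, ∑ b, M.FX S S1 S1 a b) :
    ∑ a, ∑ b, ∑ c, ind (S1 a ∧ S1 b ∧ S1 c ∧ M.H a b c) ≤ 3 * x * R := by
  have pt : ∀ a b c, ind (S1 a ∧ S1 b ∧ S1 c ∧ M.H a b c) ≤
      M.FX S S1 S1 a b * (ind (S1 c) * ind (wrong M.Q1 M.d S b c))
      + M.FX S S1 S1 a b * (ind (S1 c) * ind (wrong M.Q1 M.d S a c))
      + M.FX S S1 S1 a c * (ind (S1 b) * ind (wrong M.Q1 M.d S c b)) := by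
    intro a b c
    have n1 := mul_nonneg (M.FX_nonneg S S1 S1 a b) (mul_nonneg (ind_nonneg (S1 c))
      (ind_nonneg (wrong M.Q1 M.d S b c)))
    have n2 := mul_nonneg (M.FX_nonneg S S1 S1 a b) (mul_nonneg (ind_nonneg (S1 c))
      (ind_nonneg (wrong M.Q1 M.d S a c)))
    have n3 := mul_nonneg (M.FX_nonneg S S1 S1 a c) (mul_nonneg (ind_nonneg (S1 b))
      (ind_nonneg (wrong M.Q1 M.d S c b)))
    by_cases h : S1 a ∧ S1 b ∧ S1 c ∧ M.H a b c
    · rw [ind_true h]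
      obtain ⟨ha, hb, hc, hH⟩ := h
      unfold FX at *
      rw [ind_true ha, ind_true hb, ind_true hc] at *
      have sa := hS a ha
      have sb := hS b hb
      have sc := hS c hc
      have nab := M.ne hH
      have nbc := M.ne (M.rot hH)
      have nca := M.ne (M.rot (M.rot hH))
      have key : (wrong M.Q2 M.d S a b ∧ wrong M.Q2 M.d S b c) ∨
        (wrong M.Q2 M.d S a b ∧ wrong M.Q2 M.d S a c) ∨
        (wrong M.Q2 M.d S a c ∧ wrong M.Q2 M.d S c b) := by
        by_cases r1 : right M.Q2 M.d S a b
        · have r2 : ¬ right M.Q2 M.d S b c := fun r2 => M.LSSS sa sb sc hH r1 r2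
          have r3 : ¬ right M.Q2 M.d S a c := fun r3 => M.LSSS sb sa sc (M.sw hH) (M.s2 r1) r3
          right; right
          exact ⟨⟨nca.symm, Or.inl sa, r3⟩, ⟨nbc.symm, Or.inl sc, fun r => r2 (M.s2 r)⟩⟩
        · by_cases r2 : right M.Q2 M.d S b c
          · have r3 : ¬ right M.Q2 M.d S a c := fun r3 =>
              M.LSSS sb sc sa (M.rot hH) r2 (M.s2 r3)
            right; left
            exact ⟨⟨nab, Or.inl sa, r1⟩, ⟨nca.symm, Or.inl sa, r3⟩⟩
          · left
            exact ⟨⟨nab, Or.inl sa, r1⟩, ⟨nbc, Or.inl sb, r2⟩⟩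
      rcases key with ⟨h1, h2⟩ | ⟨h1, h2⟩ | ⟨h1, h2⟩
      · rw [ind_true h1, ind_true (M.w21 S h2)] at *
        linarith
      · rw [ind_true h1, ind_true (M.w21 S h2)] at *
        linarith
      · rw [ind_true h1, ind_true (M.w21 S h2)] at *
        linarith
    · rw [ind_false h]; linarith
  refine (sum3_le pt).trans ?_
  simp_rw [Finset.sum_add_distrib]
  have a1 : ∑ a, ∑ b, ∑ c, M.FX S S1 S1 a b * (ind (S1 c) * ind (wrong M.Q1 M.d S b c)) ≤ x * R := by
    rw [hx]
    apply sum3_deg (M.FX S S1 S1) (fun _ b c => ind (S1 c) * ind (wrong M.Q1 M.d S b c)) R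
      (M.FX_nonneg S _ _)
    intro a b h
    exact M.sum_le_deg S (hdS b (M.FX_ne S h).2)
  have a2 : ∑ a, ∑ b, ∑ c, M.FX S S1 S1 a b * (ind (S1 c) * ind (wrong M.Q1 M.d S a c)) ≤ x * R := by
    rw [hx]
    apply sum3_deg (M.FX S S1 S1) (fun a _ c => ind (S1 c) * ind (wrong M.Q1 M.d S a c)) R
      (M.FX_nonneg S _ _)
    intro a b h
    exact M.sum_le_deg S (hdS a (M.FX_ne S h).1)
  have a3 : ∑ a, ∑ b, ∑ c, M.FX S S1 S1 a c * (ind (S1 b) * ind (wrong M.Q1 M.d S c b)) ≤ x * R := by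
    rw [← sum3_swap]; exact a1
  linarith

theorem TSBB (S1 B1 : V → Prop) (hS : ∀ u, S1 u → S u) (hB : ∀ u, B1 u → ¬ S u)
    (m y : ℝ) (hm : m = sz B1) (hy : y = ∑ a, ∑ b, M.FX S S1 B1 a b) :
    ∑ a, ∑ b, ∑ c, ind (S1 a ∧ B1 b ∧ B1 c ∧ M.H a b c) ≤ 2 * y * m := by
  have pt : ∀ a b c, ind (S1 a ∧ B1 b ∧ B1 c ∧ M.H a b c) ≤
      M.FX S S1 B1 a b * ind (B1 c) + M.FX S S1 B1 a c * ind (B1 b) := by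
    intro a b c
    have n1 := mul_nonneg (M.FX_nonneg S S1 B1 a b) (ind_nonneg (B1 c))
    have n2 := mul_nonneg (M.FX_nonneg S S1 B1 a c) (ind_nonneg (B1 b))
    by_cases h : S1 a ∧ B1 b ∧ B1 c ∧ M.H a b c
    · rw [ind_true h]
      obtain ⟨ha, hb, hc, hH⟩ := h
      unfold FX at *
      rw [ind_true ha, ind_true hb, ind_true hc] at *
      have sa := hS a ha
      have nab := M.ne hH
      have nca := M.ne (M.rot (M.rot hH))
      by_cases r1 : right M.Q2 M.d S a b
      · have r2 : ¬ right M.Q2 M.d S a c := fun r2 => M.LS3 sa (hB b hb) (hB c hc) hH r1 r2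
        have w : wrong M.Q2 M.d S a c := ⟨nca.symm, Or.inl sa, r2⟩
        rw [ind_true w] at *
        linarith
      · have w : wrong M.Q2 M.d S a b := ⟨nab, Or.inl sa, r1⟩
        rw [ind_true w] at *
        linarith
    · rw [ind_false h]; linarith
  refine (sum3_le pt).trans ?_
  simp_rw [Finset.sum_add_distrib]
  have a1 : ∑ a, ∑ b, ∑ c, M.FX S S1 B1 a b * ind (B1 c) = y * m := by
    rw [sum3_deg_eq (M.FX S S1 B1) (fun _ _ b => ind (B1 b)) m (fun _ _ _ => hm.symm), hy]
  have a2 : ∑ a, ∑ b, ∑ c, M.FX S S1 B1 a c * ind (B1 b) = y * m := by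
    rw [← sum3_swap]; exact a1
  linarith

end Sys
end PC

namespace PC
open Classical Finset
set_option linter.unusedSectionVars false
variable {V : Type} [Fintype V]

theorem sz_mono {P Q : V → Prop} (h : ∀ u, P u → Q u) : sz P ≤ sz Q :=
  Finset.sum_le_sum fun u _ => ind_mono (h u)

theorem sz_or (P Q R : V → Prop) (h : ∀ u, P u → Q u ∨ R u) : sz P ≤ sz Q + sz R := by
  unfold sz
  rw [← Finset.sum_add_distrib]
  exact Finset.sum_le_sum fun u _ => (ind_mono (h u)).trans (ind_or _ _)

theorem sz_le_card (P : V → Prop) : sz P ≤ Fintype.card V := by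
  have := sz_not P
  have h2 := sz_nonneg (fun u => ¬ P u)
  linarith

theorem sz_split (P Z : V → Prop) : sz P = sz (fun u => P u ∧ ¬ Z u) + sz (fun u => P u ∧ Z u) := by
  unfold sz
  rw [← Finset.sum_add_distrib]
  apply Finset.sum_congr rfl; intro u _
  simp_rw [ind_and, ind_not]; ring

theorem arithB (n k a w d : ℝ) (hn : 0 ≤ n) (k1 : 0.615 * n ≤ k)
    (ha : 0.19 * n ≤ a) (hka : 0.01 * n ≤ k - a) (hw : w ≤ 1.1e-8 * n ^ 2)
    (hd : d ≤ w + a ^ 2 + 2 * (k - a) * (n - k)) : d ≤ k ^ 2 - 3e-4 * n ^ 2 := by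
  have h1 : 0 ≤ (k - a - 0.01 * n) * (k + a - 2 * (n - k) - 0.035 * n) :=
    mul_nonneg (by linarith) (by linarith)
  have h2 : 0 ≤ n * (k + a - 2 * (n - k) - 0.035 * n) := mul_nonneg hn (by linarith)
  have h3 : 0 ≤ n * (k - a - 0.01 * n) := mul_nonneg hn (by linarith)
  nlinarith

theorem arithS (n k a t q w d : ℝ) (hn : 0 ≤ n) (k1 : 0.615 * n ≤ k) (k2 : k ≤ 0.655 * n)
    (a0 : 0 ≤ a) (q0 : 0 ≤ q) (ha : a ≤ 0.205 * n) (hq : q ≤ n - k) (hat : a + t ≤ k)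
    (hdeg : 0.01 * n ≤ n - t - q) (hw : w ≤ 1.1e-8 * n ^ 2)
    (hd : d ≤ w + a ^ 2 + 2 * t * q + ((n - k) ^ 2 - q ^ 2)) :
    d ≤ 2 * k * (n - k) - 3e-4 * n ^ 2 := by
  obtain ⟨r, hr⟩ : ∃ r, r = k - a - t := ⟨_, rfl⟩
  obtain ⟨m, hm⟩ : ∃ m, m = n - k := ⟨_, rfl⟩
  have r0 : 0 ≤ r := by linarith
  have ht : t = k - a - r := by linarith
  rw [← hm] at hq hd ⊢
  have key : a * (2 * m - a) + (m - q) * (2 * (k - a) - m - q) + 2 * r * q ≥ 5e-4 * n ^ 2 := by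
    have e1 : a * (0.485 * n) ≤ a * (2 * m - a) :=
      mul_le_mul_of_nonneg_left (by linarith) a0
    have e2 : (m - q) * (0.05 * n) ≤ (m - q) * (2 * (k - a) - m - q) :=
      mul_le_mul_of_nonneg_left (by linarith) (by linarith)
    have e3 : 0 ≤ r * q := mul_nonneg r0 q0
    have e4 : 0 ≤ a * n := mul_nonneg a0 hn
    by_cases h : 0.1 * n ≤ q
    · have e5 : r * (0.1 * n) ≤ r * q := mul_le_mul_of_nonneg_left h r0
      have e6 : 0 ≤ (a + (m - q) + r - 0.01 * n) * n := mul_nonneg (by linarith) hn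
      have e7 : 0 ≤ r * n := mul_nonneg r0 hn
      nlinarith
    · push Not at h
      have e6 : 0 ≤ (m - q - 0.24 * n) * n := mul_nonneg (by linarith) hn
      nlinarith
  subst ht
  nlinarith [sq_nonneg n]

set_option maxHeartbeats 1000000 in
theorem arithF (n k m zs zb x y T BBB sssb sss sbb sz1 W2 : ℝ) (hn : 1e6 ≤ n)
    (hkm : n = k + m) (k1 : 0.615 * n ≤ k) (k2 : k ≤ 0.655 * n) (zs0 : 0 ≤ zs) (zb0 : 0 ≤ zb)
    (hz : zs + zb ≤ 1.2e-6 * n) (x0 : 0 ≤ x) (y0 : 0 ≤ y)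
    (h1 : sssb ≤ (k - zs) * (k - zs - 1) * (m - zb) - x * (m - zb - 0.01 * n)
      - y * (2 * (k - zs - 1) - 3 * (0.01 * n)))
    (h2 : sss ≤ 3 * x * (0.01 * n)) (h3 : sbb ≤ 2 * y * (m - zb))
    (h4 : sz1 ≤ zs * (2 * k * m - 3e-4 * n ^ 2) + zb * (k ^ 2 - 3e-4 * n ^ 2))
    (hT : T ≤ BBB + sss + 3 * sssb + 3 * sbb + 3 * sz1)
    (hW : W2 ≤ x + 2 * y + 2 * n * (zs + zb)) :
    T ≤ BBB + 3 * k * (k - 1) * m - 1e-4 * n * W2 := by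
  have hn0 : 0 ≤ n := by linarith
  have ex : x * (m - zb - 0.01 * n) ≥ x * (0.33 * n) :=
    mul_le_mul_of_nonneg_left (by linarith) x0
  have ey : y * (2 * (k - zs - 1) - 3 * (0.01 * n)) - 2 * y * (m - zb) ≥ y * (0.4 * n) := by
    have : y * (0.4 * n) ≤ y * (2 * (k - zs - 1) - 3 * (0.01 * n) - 2 * (m - zb)) :=
      mul_le_mul_of_nonneg_left (by linarith) y0
    linarith
  obtain ⟨z, hzz⟩ : ∃ z, z = zs + zb := ⟨_, rfl⟩
  rw [← hzz] at hz hW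
  have z0 : 0 ≤ z := by linarith
  have zn : n * z ^ 2 ≤ 1.2e-6 * (n ^ 2 * z) := by
    have : 0 ≤ (1.2e-6 * n - z) * (n * z) := mul_nonneg (by linarith) (by positivity)
    nlinarith
  have zn2 : n * z ≤ 1e-6 * (n ^ 2 * z) := by
    have : 0 ≤ (n - 1e6) * (n * z) := mul_nonneg (by linarith) (by positivity)
    nlinarith
  have hk0 : 0 ≤ k := by linarith
  have hm0 : 0 ≤ m := by linarith
  have c1 : (k - zs) ^ 2 * (m - zb) + zb * k ^ 2 + 2 * k * m * zs ≤ k ^ 2 * m + n * z ^ 2 := by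
    have a1 : 0 ≤ zs * zs * zb := by positivity
    have a2 : 0 ≤ k * zs * zs := by positivity
    have a3 : 0 ≤ k * zb * zb := by positivity
    have a4 : 0 ≤ m * zs * zb := by positivity
    have a5 : 0 ≤ m * zb * zb := by positivity
    rw [hkm, hzz]
    linarith
  have c2 : - ((k - zs) * (m - zb)) ≤ - (k * m) + n * z := by
    have a1 : 0 ≤ zs * zb := by positivity
    have a2 : 0 ≤ k * zs := by positivity
    have a3 : 0 ≤ m * zb := by positivity
    rw [hkm, hzz]
    linarith
  have hW' : 1e-4 * n * W2 ≤ 1e-4 * n * (x + 2 * y + 2 * n * z) :=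
    mul_le_mul_of_nonneg_left hW (by positivity)
  have xn : 0 ≤ x * n := by positivity
  have yn : 0 ≤ y * n := by positivity
  have nz : 0 ≤ n ^ 2 * z := by positivity
  have h4' : sz1 ≤ zs * (2 * k * m) + zb * k ^ 2 - 3e-4 * (n ^ 2 * z) := by
    rw [hzz]; linarith
  linarith

namespace Sys
variable (M : Sys V)

/-- decomposition of the triple sum -/
theorem decomp (S Z : V → Prop) :
    T M.H ≤ (∑ a, ∑ b, ∑ c, ind (¬ S a ∧ ¬ S b ∧ ¬ S c ∧ M.H a b c))
      + (∑ a, ∑ b, ∑ c, ind ((S a ∧ ¬ Z a) ∧ (S b ∧ ¬ Z b) ∧ (S c ∧ ¬ Z c) ∧ M.H a b c))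
      + 3 * (∑ a, ∑ b, ∑ c, ind ((S a ∧ ¬ Z a) ∧ (S b ∧ ¬ Z b) ∧ (¬ S c ∧ ¬ Z c) ∧ M.H a b c))
      + 3 * (∑ a, ∑ b, ∑ c, ind ((S a ∧ ¬ Z a) ∧ (¬ S b ∧ ¬ Z b) ∧ (¬ S c ∧ ¬ Z c) ∧ M.H a b c))
      + 3 * (∑ a, ∑ b, ∑ c, ind (Z a ∧ (S a ∨ S b ∨ S c) ∧ M.H a b c)) := by
  obtain ⟨F1, hF1⟩ : ∃ F : V → V → V → ℝ, F = fun a b c =>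
    ind ((S a ∧ ¬ Z a) ∧ (S b ∧ ¬ Z b) ∧ (¬ S c ∧ ¬ Z c) ∧ M.H a b c) := ⟨_, rfl⟩
  obtain ⟨F2, hF2⟩ : ∃ F : V → V → V → ℝ, F = fun a b c =>
    ind ((S a ∧ ¬ Z a) ∧ (¬ S b ∧ ¬ Z b) ∧ (¬ S c ∧ ¬ Z c) ∧ M.H a b c) := ⟨_, rfl⟩
  obtain ⟨F3, hF3⟩ : ∃ F : V → V → V → ℝ, F = fun a b c =>
    ind (Z a ∧ (S a ∨ S b ∨ S c) ∧ M.H a b c) := ⟨_, rfl⟩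
  have pt : ∀ a b c, ind (M.H a b c) ≤
      ind (¬ S a ∧ ¬ S b ∧ ¬ S c ∧ M.H a b c)
      + ind ((S a ∧ ¬ Z a) ∧ (S b ∧ ¬ Z b) ∧ (S c ∧ ¬ Z c) ∧ M.H a b c)
      + (F1 a b c + F1 b c a + F1 c a b) + (F2 a b c + F2 b c a + F2 c a b)
      + (F3 a b c + F3 b c a + F3 c a b) := by
    intro a b c
    rw [hF1, hF2, hF3]
    by_cases h : M.H a b c
    swap
    · rw [ind_false h]
      have := ind_nonneg
      simp only
      refine add_nonneg (add_nonneg (add_nonneg (add_nonneg (this _) (this _)) ?_) ?_) ?_ <;>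
      exact add_nonneg (add_nonneg (this _) (this _)) (this _)
    have h2 := M.rot h
    have h3 := M.rot h2
    simp only [ind, h, h2, h3, and_true, if_true]
    by_cases sa : S a <;> by_cases sb : S b <;> by_cases sc : S c <;>
    by_cases za : Z a <;> by_cases zb : Z b <;> by_cases zc : Z c <;>
    simp [sa, sb, sc, za, zb, zc]
  have := sum3_le pt
  simp_rw [Finset.sum_add_distrib] at this
  rw [sum3_rot F1, sum3_rot F2, sum3_rot F3] at this
  have r1 : ∀ F : V → V → V → ℝ, ∑ a, ∑ b, ∑ c, F c a b = ∑ a, ∑ b, ∑ c, F a b c := by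
    intro F
    rw [← sum3_rot (fun a b c => F c a b)]
  rw [r1 F1, r1 F2, r1 F3] at this
  rw [hF1, hF2, hF3] at this
  unfold T
  linarith

set_option maxHeartbeats 1000000 in
theorem FS (S0 : V → Prop) (n : ℝ) (hn : n = Fintype.card V) (hn1 : 1e6 ≤ n)
    (h1 : 0.62 * n ≤ sz S0) (h2 : sz S0 ≤ 0.65 * n) (hW : W M.Q0 M.d S0 ≤ 1e-9 * n ^ 2) :
    ∃ S : V → Prop, 0.615 * n ≤ sz S ∧ sz S ≤ 0.655 * n ∧
      T M.H ≤ (∑ a, ∑ b, ∑ c, ind (¬ S a ∧ ¬ S b ∧ ¬ S c ∧ M.H a b c))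
        + 3 * sz S * (sz S - 1) * (n - sz S) - 1e-4 * n * W M.Q2 M.d S := by
  have hn0 : 0 ≤ n := by linarith
  have hnp : 0 < n := by linarith
  obtain ⟨a0, ha0⟩ : ∃ a0 : V → ℝ, a0 = fun v => sz (fun s => S0 s ∧ M.Q1 s v ∧ M.d s v = -1) :=
    ⟨_, rfl⟩
  obtain ⟨S, hS⟩ : ∃ S : V → Prop, S = fun v => a0 v < 0.2 * n := ⟨_, rfl⟩
  obtain ⟨Δ, hΔ⟩ : ∃ D : V → Prop, D = fun v => ¬ (S v ↔ S0 v) := ⟨_, rfl⟩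
  have hΔ1 : ∀ v, S v → S0 v ∨ Δ v := fun v h => by rw [hΔ]; by_cases h0 : S0 v <;> simp [h, h0]
  have hΔ2 : ∀ v, S0 v → S v ∨ Δ v := fun v h => by rw [hΔ]; by_cases h0 : S v <;> simp [h, h0]
  -- size of the symmetric difference
  have hpt : ∀ v, ind (Δ v) * (0.2 * n) ≤ ∑ u, ind (wrong M.Q0 M.d S0 v u) := by
    intro v
    by_cases hv : Δ v
    · rw [ind_true hv, one_mul]
      by_cases hs : S v
      · have hs0 : ¬ S0 v := by
          intro h0; rw [hΔ] at hv; exact hv ⟨fun _ => h0, fun _ => hs⟩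
        have e : sz S0 ≤ a0 v + ∑ u, ind (wrong M.Q0 M.d S0 v u) := by
          rw [ha0]
          refine sz_or S0 _ (fun u => wrong M.Q0 M.d S0 v u) ?_
          intro u hu
          by_cases hr : right M.Q0 M.d S0 v u
          · left
            have r := M.r01 (M.s0 hr)
            refine ⟨hu, r.1, ?_⟩
            rw [r.2, bt_pos hu, bt_neg hs0]; decide
          · right
            exact ⟨fun e => hs0 (e ▸ hu), Or.inr hu, hr⟩
        rw [hS] at hs
        linarith
      · have hs0 : S0 v := by
          by_contra h0; rw [hΔ] at hv; exact hv ⟨fun h => absurd h hs, fun h => absurd h h0⟩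
        have e : a0 v ≤ ∑ u, ind (wrong M.Q0 M.d S0 v u) := by
          rw [ha0]
          refine sz_mono (Q := fun u => wrong M.Q0 M.d S0 v u) ?_
          rintro u ⟨hu, _, hd⟩
          refine ⟨?_, Or.inl hs0, ?_⟩
          · rintro rfl
            rw [M.as.self] at hd; exact zm02 hd
          · intro r
            have := (M.s0 r).2
            rw [hd, bt_pos hu, bt_pos hs0] at this
            revert this; decide
        rw [hS] at hs
        push Not at hs
        linarith
    · rw [ind_false hv, zero_mul]
      exact Finset.sum_nonneg fun _ _ => ind_nonneg _
  have hΔs : sz Δ ≤ 5e-9 * n := by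
    have := Finset.sum_le_sum fun v (_ : v ∈ univ) => hpt v
    rw [← Finset.sum_mul] at this
    have e : sz Δ * (0.2 * n) ≤ 1e-9 * n ^ 2 := this.trans hW
    have : n * (sz Δ * 0.2) ≤ n * (1e-9 * n) := by linarith
    have := le_of_mul_le_mul_left this hnp
    linarith
  have hΔ0 := sz_nonneg Δ
  -- W for the new S
  have hW0 : W M.Q0 M.d S ≤ 1.1e-8 * n ^ 2 := by
    have pt : ∀ u v, ind (wrong M.Q0 M.d S u v) ≤
        ind (wrong M.Q0 M.d S0 u v) + (ind (Δ u) + ind (Δ v)) := by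
      intro u v
      have := ind_nonneg (wrong M.Q0 M.d S0 u v)
      by_cases hu : Δ u
      · rw [ind_true hu]; linarith [ind_nonneg (Δ v), ind_le_one (wrong M.Q0 M.d S u v)]
      by_cases hv : Δ v
      · rw [ind_true hv]; linarith [ind_nonneg (Δ u), ind_le_one (wrong M.Q0 M.d S u v)]
      rw [ind_false hu, ind_false hv]
      have eu : S u ↔ S0 u := by rw [hΔ] at hu; exact not_not.1 hu
      have ev : S v ↔ S0 v := by rw [hΔ] at hv; exact not_not.1 hv
      have bu : bt S u = bt S0 u := by unfold bt; simp only [eu]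
      have bv : bt S v = bt S0 v := by unfold bt; simp only [ev]
      have : wrong M.Q0 M.d S u v ↔ wrong M.Q0 M.d S0 u v := by
        unfold wrong right; rw [eu, ev, bu, bv]
      rw [ind_congr this]; linarith
    have := sum2_le pt
    simp_rw [Finset.sum_add_distrib, Finset.sum_const] at this
    rw [← Finset.smul_sum] at this
    simp only [Finset.card_univ, nsmul_eq_mul] at this
    rw [← hn] at this
    have h5 : n * sz Δ ≤ n * (5e-9 * n) := mul_le_mul_of_nonneg_left hΔs hn0
    unfold W at *
    unfold sz at h5
    nlinarith
  have hk1 : 0.615 * n ≤ sz S := by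
    have := sz_or S0 S Δ hΔ2; linarith
  have hk2 : sz S ≤ 0.655 * n := by
    have := sz_or S S0 Δ hΔ1; linarith
  refine ⟨S, hk1, hk2, ?_⟩
  -- exceptional vertices
  obtain ⟨Z, hZ⟩ : ∃ Z : V → Prop, Z = fun v => 0.01 * n < ∑ u, ind (wrong M.Q1 M.d S v u) :=
    ⟨_, rfl⟩
  have hZs : sz Z ≤ 1.2e-6 * n := by
    have pt : ∀ v, ind (Z v) * (0.01 * n) ≤ ∑ u, ind (wrong M.Q0 M.d S v u) := by
      intro v
      by_cases hv : Z v
      · rw [ind_true hv, one_mul]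
        rw [hZ] at hv
        refine hv.le.trans (Finset.sum_le_sum fun u _ => ind_mono (M.w10 S))
      · rw [ind_false hv, zero_mul]
        exact Finset.sum_nonneg fun _ _ => ind_nonneg _
    have := Finset.sum_le_sum fun v (_ : v ∈ univ) => pt v
    rw [← Finset.sum_mul] at this
    have e : sz Z * (0.01 * n) ≤ 1.1e-8 * n ^ 2 := this.trans hW0
    have : n * (sz Z * 0.01) ≤ n * (1.1e-8 * n) := by linarith
    have := le_of_mul_le_mul_left this hnp
    linarith
  have hm : sz (fun u => ¬ S u) = n - sz S := by rw [sz_not, hn]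
  have splitS := sz_split S Z
  have splitB := sz_split (fun u => ¬ S u) Z
  have splitZ : sz Z = sz (fun u => S u ∧ Z u) + sz (fun u => ¬ S u ∧ Z u) := by
    unfold sz
    rw [← Finset.sum_add_distrib]
    apply Finset.sum_congr rfl; intro u _
    simp_rw [ind_and, ind_not]; ring
  have dS : ∀ u, (S u ∧ ¬ Z u) → ∑ v, ind (wrong M.Q1 M.d S u v) ≤ 0.01 * n := by
    rintro u ⟨_, h⟩; rw [hZ] at h; exact not_lt.1 h
  have dB : ∀ u, (¬ S u ∧ ¬ Z u) → ∑ v, ind (wrong M.Q1 M.d S u v) ≤ 0.01 * n := by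
    rintro u ⟨_, h⟩; rw [hZ] at h; exact not_lt.1 h
  have A1 := M.TSSB S (fun u => S u ∧ ¬ Z u) (fun u => ¬ S u ∧ ¬ Z u) (fun _ h => h.1)
    (fun _ h => h.1) (0.01 * n) dS dB _ _ _ _ rfl rfl rfl rfl
  have A2 := M.TSSS S (fun u => S u ∧ ¬ Z u) (fun _ h => h.1) (0.01 * n) dS _ rfl
  have A3 := M.TSBB S (fun u => S u ∧ ¬ Z u) (fun u => ¬ S u ∧ ¬ Z u) (fun _ h => h.1)
    (fun _ h => h.1) _ _ rfl rfl
  have hD := M.decomp S Z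
  -- contribution of exceptional vertices
  have hZc : ∑ a, ∑ b, ∑ c, ind (Z a ∧ (S a ∨ S b ∨ S c) ∧ M.H a b c) ≤
      sz (fun u => S u ∧ Z u) * (2 * sz S * (n - sz S) - 3e-4 * n ^ 2)
      + sz (fun u => ¬ S u ∧ Z u) * (sz S ^ 2 - 3e-4 * n ^ 2) := by
    have pt : ∀ z, ∑ b, ∑ c, ind (Z z ∧ (S z ∨ S b ∨ S c) ∧ M.H z b c) ≤
        ind (S z ∧ Z z) * (2 * sz S * (n - sz S) - 3e-4 * n ^ 2)
        + ind (¬ S z ∧ Z z) * (sz S ^ 2 - 3e-4 * n ^ 2) := by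
      intro z
      by_cases hz : Z z
      swap
      · rw [ind_false (fun h : S z ∧ Z z => hz h.2), ind_false (fun h : ¬ S z ∧ Z z => hz h.2)]
        have : ∀ b c, ind (Z z ∧ (S z ∨ S b ∨ S c) ∧ M.H z b c) = 0 :=
          fun b c => ind_false (fun h => hz h.1)
        simp_rw [this]; simp
      have hdeg := hz
      rw [hZ] at hdeg
      by_cases hs : S z
      · rw [ind_true (⟨hs, hz⟩ : S z ∧ Z z), ind_false (fun h : ¬ S z ∧ Z z => h.1 hs)]
        have e : ∀ b c, ind (Z z ∧ (S z ∨ S b ∨ S c) ∧ M.H z b c) = ind (M.H z b c) :=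
          fun b c => ind_congr ⟨fun h => h.2.2, fun h => ⟨hz, Or.inl hs, h⟩⟩
        simp_rw [e]
        have D := M.DS S hs (sz S) _ _ _ n rfl hn rfl rfl rfl
        rw [one_mul, zero_mul, add_zero]
        refine arithS n (sz S) _ _ _ _ _ hn0 hk1 hk2 (sz_nonneg _) (sz_nonneg _) ?_ ?_ ?_ ?_ hW0 D
        · have : sz (fun u => S u ∧ M.Q1 u z ∧ M.d u z = -1) ≤ a0 z + sz Δ := by
            rw [ha0]
            refine sz_or _ _ _ ?_
            rintro u ⟨hu, hq⟩
            rcases hΔ1 u hu with h | h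
            · exact Or.inl ⟨h, hq⟩
            · exact Or.inr h
          rw [hS] at hs
          linarith
        · rw [← hm]; exact sz_mono fun u h => h.1
        · unfold sz
          rw [← Finset.sum_add_distrib]
          refine Finset.sum_le_sum fun u _ => ?_
          by_cases su : S u
          · rw [ind_true su]
            by_cases hr : right M.Q1 M.d S z u
            · rw [ind_false (P := S u ∧ M.Q1 u z ∧ M.d u z = -1)]
              · linarith [ind_le_one (S u ∧ right M.Q1 M.d S z u)]
              · rintro ⟨_, _, hd⟩
                have := (M.s1 hr).2
                rw [hd, bt_pos su, bt_pos hs] at this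
                revert this; decide
            · rw [ind_false (P := S u ∧ right M.Q1 M.d S z u) (fun h => hr h.2)]
              linarith [ind_le_one (S u ∧ M.Q1 u z ∧ M.d u z = -1)]
          · rw [ind_false su, ind_false (fun h : S u ∧ M.Q1 u z ∧ M.d u z = -1 => su h.1),
              ind_false (fun h : S u ∧ right M.Q1 M.d S z u => su h.1)]
            simp
        · have : ∑ u, ind (wrong M.Q1 M.d S z u) ≤
            ∑ u, (1 - ind (S u ∧ right M.Q1 M.d S z u) - ind (¬ S u ∧ right M.Q1 M.d S z u)) := by
            refine Finset.sum_le_sum fun u _ => ?_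
            by_cases hr : right M.Q1 M.d S z u
            · rw [ind_false (fun h : wrong M.Q1 M.d S z u => h.2.2 hr)]
              rw [ind_and, ind_and, ind_not, ind_true hr]; linarith
            · rw [ind_false (fun h : S u ∧ right M.Q1 M.d S z u => hr h.2),
                ind_false (fun h : ¬ S u ∧ right M.Q1 M.d S z u => hr h.2)]
              linarith [ind_le_one (wrong M.Q1 M.d S z u)]
          simp_rw [Finset.sum_sub_distrib] at this
          have e1 : ∑ _u : V, (1:ℝ) = n := by rw [hn]; simp
          rw [e1] at this
          unfold sz
          linarith
      · rw [ind_true (⟨hs, hz⟩ : ¬ S z ∧ Z z), ind_false (fun h : S z ∧ Z z => hs h.1)]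
        have e : ∀ b c, ind (Z z ∧ (S z ∨ S b ∨ S c) ∧ M.H z b c) = ind (M.H z b c ∧ (S b ∨ S c)) :=
          fun b c => ind_congr ⟨fun h => ⟨h.2.2, h.2.1.resolve_left hs⟩,
            fun h => ⟨hz, Or.inr h.2, h.1⟩⟩
        simp_rw [e]
        have D := M.DB S hs (sz S) _ n rfl hn rfl
        rw [one_mul, zero_mul, zero_add]
        refine arithB n (sz S) _ _ _ hn0 hk1 ?_ ?_ hW0 D
        · have : a0 z ≤ sz (fun u => S u ∧ right M.Q1 M.d S u z) + sz Δ := by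
            rw [ha0]
            refine sz_or _ _ _ ?_
            rintro u ⟨hu, hq, hd⟩
            rcases hΔ2 u hu with h | h
            · refine Or.inl ⟨h, hq, ?_⟩
              rw [hd, bt_pos h, bt_neg hs]; decide
            · exact Or.inr h
          rw [hS] at hs
          push Not at hs
          linarith
        · have : ∑ u, ind (wrong M.Q1 M.d S z u) ≤
            ∑ u, (ind (S u) - ind (S u ∧ right M.Q1 M.d S u z)) := by
            refine Finset.sum_le_sum fun u _ => ?_
            by_cases hr : right M.Q1 M.d S z u
            · rw [ind_false (fun h : wrong M.Q1 M.d S z u => h.2.2 hr)]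
              exact sub_nonneg.2 (ind_mono fun h => h.1)
            · rw [ind_false (fun h : S u ∧ right M.Q1 M.d S u z => hr (M.s1 h.2)), sub_zero]
              exact ind_mono fun h => h.2.1.resolve_left hs
          rw [Finset.sum_sub_distrib] at this
          unfold sz
          linarith
    have := Finset.sum_le_sum fun v (_ : v ∈ univ) => pt v
    rw [Finset.sum_add_distrib, ← Finset.sum_mul, ← Finset.sum_mul] at this
    exact this
  -- total wrong weight
  have hW2 : W M.Q2 M.d S ≤
      (∑ a, ∑ b, M.FX S (fun u => S u ∧ ¬ Z u) (fun u => S u ∧ ¬ Z u) a b)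
      + 2 * (∑ a, ∑ b, M.FX S (fun u => S u ∧ ¬ Z u) (fun u => ¬ S u ∧ ¬ Z u) a b)
      + 2 * n * sz Z := by
    have pt : ∀ u v, ind (wrong M.Q2 M.d S u v) ≤
        M.FX S (fun u => S u ∧ ¬ Z u) (fun u => S u ∧ ¬ Z u) u v
        + M.FX S (fun u => S u ∧ ¬ Z u) (fun u => ¬ S u ∧ ¬ Z u) u v
        + M.FX S (fun u => S u ∧ ¬ Z u) (fun u => ¬ S u ∧ ¬ Z u) v u
        + (ind (Z u) + ind (Z v)) := by
      intro u v
      have f1 := M.FX_nonneg S (fun u => S u ∧ ¬ Z u) (fun u => S u ∧ ¬ Z u) u v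
      have f2 := M.FX_nonneg S (fun u => S u ∧ ¬ Z u) (fun u => ¬ S u ∧ ¬ Z u) u v
      have f3 := M.FX_nonneg S (fun u => S u ∧ ¬ Z u) (fun u => ¬ S u ∧ ¬ Z u) v u
      have g1 := ind_nonneg (Z u)
      have g2 := ind_nonneg (Z v)
      by_cases w : wrong M.Q2 M.d S u v
      · have w' := wrong_symm M.Q2s M.as w
        unfold FX at *
        rw [ind_true w, ind_true w'] at *
        by_cases zu : Z u
        · rw [ind_true zu] at *; linarith
        by_cases zv : Z v
        · rw [ind_true zv] at *; linarith
        have hs := w.2.1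
        by_cases su : S u <;> by_cases sv : S v <;> simp [ind, su, sv, zu, zv] at hs ⊢
      · rw [ind_false w]; linarith
    have := sum2_le pt
    simp_rw [Finset.sum_add_distrib, Finset.sum_const] at this
    rw [← Finset.smul_sum] at this
    simp only [Finset.card_univ, nsmul_eq_mul] at this
    rw [← hn, Finset.sum_comm (f := fun u v => M.FX S (fun u => S u ∧ ¬ Z u)
      (fun u => ¬ S u ∧ ¬ Z u) v u)] at this
    unfold W
    have : n * sz Z = n * ∑ x, ind (Z x) := rfl
    linarith
  refine arithF n (sz S) (n - sz S) (sz (fun u => S u ∧ Z u)) (sz (fun u => ¬ S u ∧ Z u)) _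
    (∑ a, ∑ b, M.FX S (fun u => S u ∧ ¬ Z u) (fun u => ¬ S u ∧ ¬ Z u) a b) _ _
    _ _ _ _ _ hn1 (by ring) hk1 hk2 (sz_nonneg _) (sz_nonneg _) (by linarith) ?_ ?_ ?_ A2 ?_ hZc hD ?_
  · exact Finset.sum_nonneg fun _ _ => Finset.sum_nonneg fun _ _ => M.FX_nonneg _ _ _ _ _
  · exact Finset.sum_nonneg fun _ _ => Finset.sum_nonneg fun _ _ => M.FX_nonneg _ _ _ _ _
  · have e1 : sz (fun u => S u ∧ ¬ Z u) = sz S - sz (fun u => S u ∧ Z u) := by linarith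
    have e2 : sz (fun u => ¬ S u ∧ ¬ Z u) = n - sz S - sz (fun u => ¬ S u ∧ Z u) := by linarith
    rw [e1, e2] at A1
    exact A1
  · have e2 : sz (fun u => ¬ S u ∧ ¬ Z u) = n - sz S - sz (fun u => ¬ S u ∧ Z u) := by linarith
    rw [e2] at A3
    exact A3
  · rw [← splitZ]; exact hW2

end Sys
end PC

namespace PC
set_option synthInstance.maxSize 2000 in
set_option synthInstance.maxHeartbeats 200000 in
theorem dec_xyz : ∀ x y z : ZMod 3, ((y = x - 1 ∧ z = y - 1) ∧ (x = 0 ∧ -z = -1 ∧ y = -1) ∧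
          ¬ (y = 0 ∧ -x = -1 ∧ z = -1) ∧ ¬ (z = 0 ∧ -y = -1 ∧ x = -1)) ∨
          ((y = x - 1 ∧ z = y - 1) ∧ ¬ (x = 0 ∧ -z = -1 ∧ y = -1) ∧
          (y = 0 ∧ -x = -1 ∧ z = -1) ∧ ¬ (z = 0 ∧ -y = -1 ∧ x = -1)) ∨
          ((y = x - 1 ∧ z = y - 1) ∧ ¬ (x = 0 ∧ -z = -1 ∧ y = -1) ∧
          ¬ (y = 0 ∧ -x = -1 ∧ z = -1) ∧ (z = 0 ∧ -y = -1 ∧ x = -1)) ∨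
          (¬ (y = x - 1 ∧ z = y - 1) ∧ ¬ (x = 0 ∧ -z = -1 ∧ y = -1) ∧
          ¬ (y = 0 ∧ -x = -1 ∧ z = -1) ∧ ¬ (z = 0 ∧ -y = -1 ∧ x = -1)) := by decide

end PC

namespace PC
open Classical Finset
set_option linter.unusedSectionVars false

section
variable {V : Type}

/-- triples consistent with the colouring -/
def Rd (d : V → V → ZMod 3) (a b c : V) : Prop :=
  (a ≠ b ∧ b ≠ c ∧ c ≠ a) ∧ d b c = d a b - 1 ∧ d c a = d b c - 1

theorem zr1 : ∀ x y z : ZMod 3, y = x - 1 → z = y - 1 → -z = -x - 1 ∧ -y = -z - 1 ∧ x = z - 1 := by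
  decide

def Rsys (d : V → V → ZMod 3) (h : Asym d) : Sys V where
  H := Rd d
  d := d
  Q0 := fun _ _ => True
  Q1 := fun _ _ => True
  Q2 := fun _ _ => True
  sw := by
    rintro a b c ⟨⟨n1, n2, n3⟩, h1, h2⟩
    refine ⟨⟨n1.symm, n3.symm, n2.symm⟩, ?_⟩
    rw [h c a, h a b, h b c]
    obtain ⟨e1, e2, _⟩ := zr1 _ _ _ h1 h2
    exact ⟨e1, e2⟩
  rot := by
    rintro a b c ⟨⟨n1, n2, n3⟩, h1, h2⟩
    exact ⟨⟨n2, n3, n1⟩, h2, (zr1 _ _ _ h1 h2).2.2⟩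
  ne := fun h => h.1.1
  as := h
  Q0s := id
  Q1s := id
  Q2s := id
  Q01 := id
  Q12 := id
  cl0 := fun _ _ => trivial
  cl1 := fun _ _ => trivial
  con := fun h _ _ => h.2.1

end

variable {V : Type} [Fintype V]

theorem T_Rd (d : V → V → ZMod 3) (h : Asym d) : T (Rd d) = 3 * p d := by
  obtain ⟨F, hF⟩ : ∃ F : V → V → V → ℝ, F = fun a b c =>
    ind (a ≠ b ∧ d a b = 0 ∧ d a c = -1 ∧ d b c = -1) := ⟨_, rfl⟩
  have pt : ∀ a b c, ind (Rd d a b c) = F a b c + F b c a + F c a b := by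
    intro a b c
    rw [hF]
    unfold Rd
    simp only
    by_cases hd : a ≠ b ∧ b ≠ c ∧ c ≠ a
    · obtain ⟨h1, h2, h3⟩ := hd
      rw [h c a, h a b, h b c]
      simp only [h1, h2, h3, ne_eq, not_false_eq_true, true_and, and_self]
      generalize d a b = x
      generalize d b c = y
      generalize d c a = z
      rcases dec_xyz x y z with ⟨h1, h2, h3, h4⟩ | ⟨h1, h2, h3, h4⟩ | ⟨h1, h2, h3, h4⟩ | ⟨h1, h2, h3, h4⟩
      · rw [ind_true h1, ind_true h2, ind_false h3, ind_false h4]; norm_num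
      · rw [ind_true h1, ind_false h2, ind_true h3, ind_false h4]; norm_num
      · rw [ind_true h1, ind_false h2, ind_false h3, ind_true h4]; norm_num
      · rw [ind_false h1, ind_false h2, ind_false h3, ind_false h4]; norm_num
    · rw [ind_false (fun q => hd q.1)]
      have key : ∀ a b c : V, ¬ (a ≠ b ∧ b ≠ c ∧ c ≠ a) →
          ind (a ≠ b ∧ d a b = 0 ∧ d a c = -1 ∧ d b c = -1) = 0 := by
        intro a b c hd
        apply ind_false
        rintro ⟨n1, _, e2, e3⟩
        apply hd
        refine ⟨n1, ?_, ?_⟩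
        · rintro rfl; rw [h.self] at e3; exact zm02 e3
        · rintro rfl; rw [h.self] at e2; exact zm02 e2
      rw [key a b c hd, key b c a (fun q => hd ⟨q.2.2, q.1, q.2.1⟩),
        key c a b (fun q => hd ⟨q.2.1, q.2.2, q.1⟩)]
      norm_num
  unfold T
  simp_rw [pt, Finset.sum_add_distrib]
  rw [sum3_rot F]
  have r1 : ∑ a, ∑ b, ∑ c, F c a b = ∑ a, ∑ b, ∑ c, F a b c := by
    rw [← sum3_rot (fun a b c => F c a b)]
  rw [r1, hF]
  unfold p
  ring

theorem T_sub (B : V → Prop) (H : V → V → V → Prop) :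
    ∑ a, ∑ b, ∑ c, ind (B a ∧ B b ∧ B c ∧ H a b c) =
      T (fun a b c : {a // B a} => H a.1 b.1 c.1) := by
  unfold T
  rw [sum_sub3 B (fun a b c => ind (H a b c))]
  simp_rw [ind_and]

theorem T_sub_Rd (B : V → Prop) (d : V → V → ZMod 3) (h : Asym d) :
    ∑ a, ∑ b, ∑ c, ind (B a ∧ B b ∧ B c ∧ Rd d a b c) ≤ 6 * A * (sz B) ^ 3 := by
  rw [T_sub]
  have e : (fun a b c : {a // B a} => Rd d a.1 b.1 c.1) = Rd (fun a b : {a // B a} => d a.1 b.1) := by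
    funext a b c
    unfold Rd
    simp only [ne_eq, Subtype.ext_iff]
  have as : Asym (fun a b : {a // B a} => d a.1 b.1) := fun a b => h _ _
  rw [e, T_Rd _ as]
  have := ub _ as
  rw [card_sub] at this
  unfold sz
  linarith

theorem boot (d : V → V → ZMod 3) (h : Asym d) (ε : ℝ) (h0 : 0 ≤ ε) (h1 : ε ≤ 5e-7)
    (hn : (1e6 : ℝ) ≤ Fintype.card V)
    (hp : (2 * A - ε) * (Fintype.card V : ℝ) ^ 3 ≤ p d) (hN : Near 1e-9 d) : Near (3e4 * ε) d := by
  obtain ⟨S0, s1, s2, s3⟩ := hN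
  obtain ⟨S, k1, k2, hT⟩ := (Rsys d h).FS S0 _ rfl hn s1 s2 s3
  have hB := T_sub_Rd (fun a => ¬ S a) d h
  have e : (Rsys d h).H = Rd d := rfl
  have e2 : W (Rsys d h).Q2 (Rsys d h).d S = W (fun _ _ => True) d S := rfl
  rw [e, T_Rd d h, e2] at hT
  rw [sz_not] at hB
  have w0 := W_nonneg (fun _ _ => True) d S
  unfold Near
  generalize ((Fintype.card V : ℕ) : ℝ) = n at *
  generalize W (fun _ _ => True) d S = w at *
  obtain ⟨k, hk⟩ : ∃ k, k = sz S := ⟨_, rfl⟩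
  have key := key_identity n k
  have n0 : 0 < n := by linarith
  have kn : 0 ≤ k * (n - k) := by
    rw [hk]; exact mul_nonneg (by linarith) (by linarith)
  rw [← hk] at k1 k2 hT hB
  have main : 3 * k * (1 + 2 * A) * (k - x0 * n) ^ 2 + 1e-4 * n * w ≤ 3 * ε * n ^ 3 := by
    nlinarith
  have pos1 : 0 ≤ 3 * k * (1 + 2 * A) * (k - x0 * n) ^ 2 := by
    have := A_lb
    have : 0 ≤ k := by linarith
    have : 0 ≤ 1 + 2 * A := by linarith
    positivity
  have wb : w ≤ 3e4 * ε * n ^ 2 := by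
    have : n * (1e-4 * w) ≤ n * (3 * ε * n ^ 2) := by linarith
    have := le_of_mul_le_mul_left this n0
    linarith
  have sq : (k - x0 * n) ^ 2 ≤ (0.001 * n) ^ 2 := by
    have e1 : 1.845 * n * (k - x0 * n) ^ 2 ≤ 3 * k * (1 + 2 * A) * (k - x0 * n) ^ 2 := by
      apply mul_le_mul_of_nonneg_right _ (sq_nonneg _)
      have := A_lb
      have : 0 ≤ k * A := mul_nonneg (by linarith) (by linarith)
      nlinarith
    have e2 : 0 ≤ n * w := mul_nonneg n0.le w0
    have e3 : n * (1.845 * (k - x0 * n) ^ 2) ≤ n * (3 * ε * n ^ 2) := by linarith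
    have e4 := le_of_mul_le_mul_left e3 n0
    have e5 : ε * n ^ 2 ≤ 5e-7 * n ^ 2 := mul_le_mul_of_nonneg_right h1 (sq_nonneg _)
    nlinarith
  have ab := abs_le.1 (abs_le_of_sq_le_sq sq (by linarith))
  obtain ⟨b1, b2⟩ := ab
  have x1 : 0.633 * n ≤ x0 * n := mul_le_mul_of_nonneg_right x0_lb.le n0.le
  have x2 : x0 * n ≤ 0.635 * n := mul_le_mul_of_nonneg_right x0_ub.le n0.le
  refine ⟨S, ?_, ?_, ?_⟩
  · rw [← hk]; linarith
  · rw [← hk]; linarith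
  · exact (show W (fun _ _ => True) d S = w from e2).trans_le wb

theorem Near.mono {d : V → V → ZMod 3} {η η' : ℝ} (h : Near η d) (hh : η ≤ η') : Near η' d := by
  obtain ⟨S, a, b, c⟩ := h
  exact ⟨S, a, b, c.trans (mul_le_mul_of_nonneg_right hh (sq_nonneg _))⟩

theorem W_conv (d : V → V → ZMod 3) (S : V → Prop) (x y : V) :
    W (fun _ _ => True) d S ≤ W (fun _ _ => True) (conv d x y) S + 2 * Fintype.card V := by
  have pt : ∀ u v, ind (wrong (fun _ _ => True) d S u v) ≤
      ind (wrong (fun _ _ => True) (conv d x y) S u v) + (ind (u = x) + ind (v = x)) := by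
    intro u v
    have := ind_nonneg (wrong (fun _ _ => True) (conv d x y) S u v)
    have l := ind_le_one (wrong (fun _ _ => True) d S u v)
    by_cases hu : u = x
    · rw [ind_true hu]; linarith [ind_nonneg (v = x)]
    by_cases hv : v = x
    · rw [ind_true hv]; linarith [ind_nonneg (u = x)]
    rw [ind_false hu, ind_false hv]
    have e : conv d x y u v = d u v := by unfold conv; rw [sg_of_ne hu, sg_of_ne hv]
    have : wrong (fun _ _ => True) d S u v ↔ wrong (fun _ _ => True) (conv d x y) S u v := by
      unfold wrong right; rw [e]
    rw [ind_congr this]; linarith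
  have := sum2_le pt
  simp_rw [Finset.sum_add_distrib, Finset.sum_const] at this
  rw [← Finset.smul_sum] at this
  have e : ∑ u : V, ind (u = x) = 1 := by simp [ind]
  simp only [Finset.card_univ, nsmul_eq_mul, e] at this
  unfold W
  linarith

theorem stab (d : V → V → ZMod 3) (h : Asym d) (ε : ℝ) (h0 : 0 ≤ ε) (h1 : ε ≤ 1e-14)
    (hn : (1e10 : ℝ) ≤ Fintype.card V)
    (hp : (2 * A - ε) * (Fintype.card V : ℝ) ^ 3 ≤ p d) : Near (3e4 * ε) d := by
  apply boot d h ε h0 (by linarith) (by linarith) hp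
  by_contra hN
  obtain ⟨e, ⟨ea, ep, eN⟩, -, eb⟩ := zykov (V := V)
    (fun d => Asym d ∧ (2 * A - ε) * (Fintype.card V : ℝ) ^ 3 ≤ p d ∧ ¬ Near 1e-9 d)
    (fun d h => h.1) (by
      rintro d x y ⟨ha, hp, hN⟩ - hle
      refine ⟨ha.conv x y, hp.trans hle, fun hc => hN ?_⟩
      obtain ⟨S, a, b, c⟩ := boot _ (ha.conv x y) ε h0 (by linarith) (by linarith) (hp.trans hle) hc
      refine ⟨S, a, b, ?_⟩
      have := W_conv d S x y
      generalize ((Fintype.card V : ℕ) : ℝ) = n at *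
      have e1 : 3e4 * ε * n ^ 2 ≤ 3e-10 * n ^ 2 :=
        mul_le_mul_of_nonneg_right (by linarith) (sq_nonneg _)
      nlinarith) d ⟨h, hp, hN⟩
  exact eN ((near_of_sym ea eb h0 (by linarith) ep).mono (by linarith))

end PC

namespace PC
open Classical Finset
set_option linter.unusedSectionVars false

section
variable {V : Type}

/-- no short closed walk of length not divisible by three -/
def NoBad (L : ℕ) (H : V → V → V → Prop) : Prop :=
  ∀ ℓ : ℕ, 3 ≤ ℓ → ℓ ≤ L → ¬ (3 ∣ ℓ) → ¬ ∃ v : ZMod ℓ → V, ∀ i, H (v i) (v (i + 1)) (v (i + 2))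

/-- step between ordered pairs -/
def St (H : V → V → V → Prop) (x y : V × V) : Prop := x.2 = y.1 ∧ H x.1 x.2 y.2

/-- walks on ordered pairs -/
def Wk (H : V → V → V → Prop) : ℕ → V × V → V × V → Prop
  | 0, x, y => x = y
  | l + 1, x, y => ∃ z, Wk H l x z ∧ St H z y

variable {H : V → V → V → Prop}

theorem Wk.trans {l m : ℕ} {x y z : V × V} (h1 : Wk H l x y) (h2 : Wk H m y z) :
    Wk H (l + m) x z := by
  induction m generalizing z with
  | zero => cases h2; exact h1
  | succ m ih =>
    obtain ⟨w, hw, hs⟩ := h2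
    exact ⟨w, ih hw, hs⟩

theorem Wk.one {x y : V × V} (h : St H x y) : Wk H 1 x y := ⟨x, rfl, h⟩

theorem Wk.rev (rot : ∀ {a b c}, H a b c → H b c a) {l : ℕ} {x y : V × V} (h : Wk H l x y) :
    Wk H (2 * l) y x := by
  induction l generalizing y with
  | zero => cases h; rfl
  | succ l ih =>
    obtain ⟨w, hw, hs⟩ := h
    have h2 : Wk H 2 y w := by
      obtain ⟨e, hh⟩ := hs
      refine (Wk.one (y := (y.2, w.1)) ⟨rfl, ?_⟩).trans (Wk.one ⟨rfl, ?_⟩)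
      · rw [← e]; exact rot hh
      · exact rot (rot hh)
    have := h2.trans (ih hw)
    rwa [show 2 * (l + 1) = 2 + 2 * l by ring]

theorem Wk.path {l : ℕ} {x y : V × V} (h : Wk H l x y) :
    ∃ g : ℕ → V × V, g 0 = x ∧ g l = y ∧ ∀ i < l, St H (g i) (g (i + 1)) := by
  induction l generalizing y with
  | zero => cases h; exact ⟨fun _ => x, rfl, rfl, fun i hi => absurd hi (Nat.not_lt_zero i)⟩
  | succ l ih =>
    obtain ⟨w, hw, hs⟩ := h
    obtain ⟨g, h0, hl, hg⟩ := ih hw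
    refine ⟨fun i => if i ≤ l then g i else y, ?_, ?_, ?_⟩
    · simp [h0]
    · simp
    · intro i hi
      rcases Nat.lt_or_ge i l with h | h
      · have h1 : i ≤ l := h.le
        have h2 : i + 1 ≤ l := h
        simp only [h1, h2, if_true]
        exact hg i h
      · have : i = l := by omega
        subst this
        simp only [le_refl, if_true, show ¬ (i + 1 ≤ i) by omega, if_false]
        rw [hl]; exact hs

theorem Wk.cycle {l : ℕ} {x : V × V} (hl : 3 ≤ l) (h : Wk H l x x) :
    ∃ v : ZMod l → V, ∀ i, H (v i) (v (i + 1)) (v (i + 2)) := by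
  obtain ⟨g, h0, hl', hg⟩ := h.path
  haveI : NeZero l := ⟨by omega⟩
  have hlt : 0 < l := by omega
  have hs : ∀ j, St H (g (j % l)) (g ((j + 1) % l)) := by
    intro j
    have hj := Nat.mod_lt j hlt
    have := hg (j % l) hj
    rcases Nat.lt_or_ge (j % l + 1) l with h | h
    · have e : (j + 1) % l = j % l + 1 := by
        rw [Nat.add_mod, Nat.mod_eq_of_lt (show 1 < l by omega), Nat.mod_eq_of_lt h]
      rw [e]; exact this
    · have e0 : j % l + 1 = l := by omega
      have e : (j + 1) % l = 0 := by
        rw [Nat.add_mod, Nat.mod_eq_of_lt (show 1 < l by omega), e0, Nat.mod_self]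
      rw [e, h0]
      rw [e0, hl'] at this
      exact this
  refine ⟨fun i => (g (i.val % l)).1, fun i => ?_⟩
  have v1 : (i + 1).val % l = (i.val + 1) % l := by
    rw [ZMod.val_add, ZMod.val_one'' (by omega)]
    simp
  have v2 : (i + 2).val % l = (i.val + 1 + 1) % l := by
    rw [show i + 2 = (i + 1) + 1 by ring, ZMod.val_add, ZMod.val_one'' (by omega), Nat.mod_mod,
      Nat.add_mod, v1]
    simp [Nat.add_mod]
  simp only [v1, v2]
  have s1 := hs i.val
  have s2 := hs (i.val + 1)
  rw [← s2.1, ← s1.1]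
  exact s1.2

theorem NoBad.dvd {L : ℕ} (h : NoBad L H) {l : ℕ} {x : V × V} (hw : Wk H l x x) (hl : 4 * l ≤ L) :
    3 ∣ l := by
  by_contra hd
  have h4 : Wk H (4 * l) x x := by
    have := ((hw.trans hw).trans hw).trans hw
    rwa [show 4 * l = l + l + l + l by ring]
  refine h (4 * l) ?_ hl ?_ (h4.cycle ?_)
  · have : l ≠ 0 := by rintro rfl; simp at hd
    omega
  · omega
  · have : l ≠ 0 := by rintro rfl; simp at hd
    omega

/-- sparsify a set of roots -/
theorem sparsify (X : V × V → Prop) : ∀ (N : ℕ) (I : Finset (V × V)) (D : ℕ), I.card = N →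
    (∀ x, X x → ∃ r ∈ I, ∃ l ≤ D, Wk H l r x) →
    ∃ (J : Finset (V × V)) (D' : ℕ), D ≤ D' ∧ D' ≤ D * 7 ^ N ∧
      (∀ x, X x → ∃ r ∈ J, ∃ l ≤ D', Wk H l r x) ∧
      (∀ r ∈ J, ∀ r' ∈ J, ∀ l ≤ 6 * D', Wk H l r r' → r = r') := by
  intro N
  induction N with
  | zero =>
    intro I D hI hc
    refine ⟨I, D, le_rfl, by simp, hc, ?_⟩
    intro r hr
    rw [Finset.card_eq_zero.1 hI] at hr
    exact absurd hr (Finset.notMem_empty r)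
  | succ N ih =>
    intro I D hI hc
    by_cases hsp : ∀ r ∈ I, ∀ r' ∈ I, ∀ l ≤ 6 * D, Wk H l r r' → r = r'
    · exact ⟨I, D, le_rfl, Nat.le_mul_of_pos_right _ (by positivity), hc, hsp⟩
    · push Not at hsp
      obtain ⟨r, hr, r', hr', l, hl, hw, hne⟩ := hsp
      obtain ⟨J, D', h1, h2, h3, h4⟩ := ih (I.erase r') (7 * D)
        (by rw [Finset.card_erase_of_mem hr', hI]; rfl) (by
          intro x hx
          obtain ⟨s, hs, m, hm, hws⟩ := hc x hx
          by_cases e : s = r'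
          · subst e
            exact ⟨r, Finset.mem_erase.2 ⟨hne, hr⟩, l + m, by omega, hw.trans hws⟩
          · exact ⟨s, Finset.mem_erase.2 ⟨e, hs⟩, m, by omega, hws⟩)
      refine ⟨J, D', by omega, ?_, h3, h4⟩
      calc D' ≤ 7 * D * 7 ^ N := h2
        _ = D * 7 ^ (N + 1) := by ring

/-- pairs near a root set -/
def Nr (H : V → V → V → Prop) (J : Finset (V × V)) (E : ℕ) (x : V × V) : Prop :=
  ∃ r ∈ J, ∃ l ≤ E, Wk H l r x

noncomputable def ph (H : V → V → V → Prop) (J : Finset (V × V)) (E : ℕ) (x : V × V) : ZMod 3 :=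
  if h : ∃ l : ℕ, l ≤ E ∧ ∃ r ∈ J, Wk H l r x then ((Classical.choose h : ℕ) : ZMod 3) else 0

theorem ph_spec {J : Finset (V × V)} {E : ℕ} {x : V × V} (h : Nr H J E x) :
    ∃ l : ℕ, l ≤ E ∧ (∃ r ∈ J, Wk H l r x) ∧ ph H J E x = (l : ZMod 3) := by
  have h' : ∃ l : ℕ, l ≤ E ∧ ∃ r ∈ J, Wk H l r x := by
    obtain ⟨r, hr, l, hl, hw⟩ := h
    exact ⟨l, hl, r, hr, hw⟩
  refine ⟨Classical.choose h', (Classical.choose_spec h').1, (Classical.choose_spec h').2, ?_⟩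
  unfold ph
  rw [dif_pos h']

theorem ph_step {L : ℕ} (hb : NoBad L H) (rot : ∀ {a b c}, H a b c → H b c a)
    {J : Finset (V × V)} {D : ℕ} (hD : 6 ≤ D) (hL : 4 * (6 * D) ≤ L)
    (hs : ∀ r ∈ J, ∀ r' ∈ J, ∀ l ≤ 6 * D, Wk H l r r' → r = r')
    {x y : V × V} (hx : Nr H J (D + 4) x) (hy : Nr H J (D + 4) y) (h : St H x y) :
    ph H J (D + 4) y = ph H J (D + 4) x + 1 := by
  obtain ⟨l, hl, ⟨r, hr, hw⟩, e1⟩ := ph_spec hx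
  obtain ⟨m, hm, ⟨s, hs', hw'⟩, e2⟩ := ph_spec hy
  have w : Wk H (l + 1 + 2 * m) r s := (hw.trans (Wk.one h)).trans (hw'.rev rot)
  have := hs r hr s hs' _ (by omega) w
  subst this
  have dv := hb.dvd w (by omega)
  rw [e1, e2]
  have : ((l + 1 + 2 * m : ℕ) : ZMod 3) = 0 := (ZMod.natCast_eq_zero_iff _ _).2 dv
  push_cast at this
  have key : ∀ a b : ZMod 3, a + 1 + 2 * b = 0 → b = a + 1 := by decide
  exact key _ _ this

noncomputable def mkSys {L : ℕ} (hb : NoBad L H) (sw : ∀ {a b c}, H a b c → H b a c)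
    (rot : ∀ {a b c}, H a b c → H b c a) (ne : ∀ {a b c}, H a b c → a ≠ b)
    (J : Finset (V × V)) (D : ℕ) (hD : 6 ≤ D) (hL : 4 * (6 * D) ≤ L)
    (hs : ∀ r ∈ J, ∀ r' ∈ J, ∀ l ≤ 6 * D, Wk H l r r' → r = r') : Sys V where
  H := H
  d := fun a b => ph H J (D + 4) (a, b) - ph H J (D + 4) (b, a)
  Q0 := fun a b => Nr H J D (a, b) ∧ Nr H J D (b, a)
  Q1 := fun a b => Nr H J (D + 2) (a, b) ∧ Nr H J (D + 2) (b, a)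
  Q2 := fun a b => Nr H J (D + 4) (a, b) ∧ Nr H J (D + 4) (b, a)
  sw := sw
  rot := rot
  ne := ne
  as := fun a b => by ring
  Q0s := And.symm
  Q1s := And.symm
  Q2s := And.symm
  Q01 := by
    rintro a b ⟨⟨r, hr, l, hl, hw⟩, ⟨r', hr', l', hl', hw'⟩⟩
    exact ⟨⟨r, hr, l, by omega, hw⟩, ⟨r', hr', l', by omega, hw'⟩⟩
  Q12 := by
    rintro a b ⟨⟨r, hr, l, hl, hw⟩, ⟨r', hr', l', hl', hw'⟩⟩
    exact ⟨⟨r, hr, l, by omega, hw⟩, ⟨r', hr', l', by omega, hw'⟩⟩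
  cl0 := by
    rintro a b c h ⟨⟨r, hr, l, hl, hw⟩, ⟨r', hr', l', hl', hw'⟩⟩
    refine ⟨⟨r, hr, l + 1, by omega, hw.trans (Wk.one ⟨rfl, h⟩)⟩,
      ⟨r', hr', l' + 1 + 1, by omega, (hw'.trans (Wk.one (y := (a, c)) ⟨rfl, sw h⟩)).trans
        (Wk.one ⟨rfl, rot (sw h)⟩)⟩⟩
  cl1 := by
    rintro a b c h ⟨⟨r, hr, l, hl, hw⟩, ⟨r', hr', l', hl', hw'⟩⟩
    refine ⟨⟨r, hr, l + 1, by omega, hw.trans (Wk.one ⟨rfl, h⟩)⟩,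
      ⟨r', hr', l' + 1 + 1, by omega, (hw'.trans (Wk.one (y := (a, c)) ⟨rfl, sw h⟩)).trans
        (Wk.one ⟨rfl, rot (sw h)⟩)⟩⟩
  con := by
    rintro a b c h ⟨h1, h2⟩ ⟨h3, h4⟩
    have e1 := ph_step hb rot hD hL hs h1 h3 ⟨rfl, h⟩
    have e2 := ph_step hb rot hD hL hs h4 h2 ⟨rfl, sw (rot h)⟩
    rw [e1, e2]
    generalize ph H J (D + 4) (a, b) = x
    generalize ph H J (D + 4) (c, b) = y
    revert x y
    decide

end

end PC

namespace PC
open Classical Finset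
set_option linter.unusedSectionVars false

section
variable {V : Type} [Fintype V] {H : V → V → V → Prop}

/-- triples all of whose (cyclic) pairs lie in X -/
def HX (H : V → V → V → Prop) (X : Finset (V × V)) (a b c : V) : Prop :=
  H a b c ∧ (a, b) ∈ X ∧ (b, c) ∈ X ∧ (c, a) ∈ X

theorem HX.rot' (rot : ∀ {a b c}, H a b c → H b c a) {X : Finset (V × V)} {a b c : V}
    (h : HX H X a b c) : HX H X b c a := ⟨rot h.1, h.2.2.1, h.2.2.2, h.2.1⟩

theorem sum3_point (a b : V) (P : V → Prop) :
    ∑ x, ∑ y, ∑ z, ind (x = a ∧ y = b ∧ P z) = ∑ z, ind (P z) := by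
  simp only [ind_and]
  simp only [← Finset.mul_sum]
  simp [ind]

theorem T_erase (rot : ∀ {a b c}, H a b c → H b c a) (X : Finset (V × V)) (a b : V) :
    T (HX H X) ≤ T (HX H (X.erase (a, b))) + 3 * ∑ c, ind (HX H X a b c) := by
  have e1 := sum3_point a b (fun z => HX H X a b z)
  have e2 := sum3_rot (fun x y z => ind (x = a ∧ y = b ∧ HX H X a b z))
  have e3 := sum3_rot (fun y z x => ind (x = a ∧ y = b ∧ HX H X a b z))
  have e4 := sum3_rot (fun z x y => ind (x = a ∧ y = b ∧ HX H X a b z))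
  have key : T (HX H X) ≤ ∑ x, ∑ y, ∑ z, (ind (HX H (X.erase (a, b)) x y z)
      + ind (x = a ∧ y = b ∧ HX H X a b z) + ind (y = a ∧ z = b ∧ HX H X a b x)
      + ind (z = a ∧ x = b ∧ HX H X a b y)) := by
    unfold T
    refine Finset.sum_le_sum fun x _ => Finset.sum_le_sum fun y _ => Finset.sum_le_sum fun z _ => ?_
    have g0 := ind_nonneg (HX H (X.erase (a, b)) x y z)
    have g1 := ind_nonneg (x = a ∧ y = b ∧ HX H X a b z)
    have g2 := ind_nonneg (y = a ∧ z = b ∧ HX H X a b x)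
    have g3 := ind_nonneg (z = a ∧ x = b ∧ HX H X a b y)
    by_cases h : HX H X x y z
    · by_cases h1 : x = a ∧ y = b
      · have : x = a ∧ y = b ∧ HX H X a b z := by
          obtain ⟨rfl, rfl⟩ := h1; exact ⟨rfl, rfl, h⟩
        rw [ind_true h, ind_true this]; linarith
      by_cases h2 : y = a ∧ z = b
      · have : y = a ∧ z = b ∧ HX H X a b x := by
          obtain ⟨rfl, rfl⟩ := h2; exact ⟨rfl, rfl, h.rot' rot⟩
        rw [ind_true h, ind_true this]; linarith
      by_cases h3 : z = a ∧ x = b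
      · have : z = a ∧ x = b ∧ HX H X a b y := by
          obtain ⟨rfl, rfl⟩ := h3; exact ⟨rfl, rfl, (h.rot' rot).rot' rot⟩
        rw [ind_true h, ind_true this]; linarith
      have : HX H (X.erase (a, b)) x y z := by
        refine ⟨h.1, ?_, ?_, ?_⟩
        · exact Finset.mem_erase.2 ⟨fun e => h1 (Prod.mk.inj e), h.2.1⟩
        · exact Finset.mem_erase.2 ⟨fun e => h2 (Prod.mk.inj e), h.2.2.1⟩
        · exact Finset.mem_erase.2 ⟨fun e => h3 (Prod.mk.inj e), h.2.2.2⟩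
      rw [ind_true h, ind_true this]; linarith
    · rw [ind_false h]; linarith
  simp only [Finset.sum_add_distrib] at key
  have k0 : T (HX H (X.erase (a, b))) = ∑ x, ∑ y, ∑ z, ind (HX H (X.erase (a, b)) x y z) := rfl
  rw [← k0] at key
  linarith

theorem clean1 (rot : ∀ {a b c}, H a b c → H b c a) (δ : ℝ) (n : ℝ) (hn : n = Fintype.card V)
    (hδ : 0 ≤ δ) :
    ∃ X : Finset (V × V), T H - δ * n ^ 3 ≤ T (HX H X) ∧
      ∀ a b, (a, b) ∈ X → δ * n ≤ 3 * ∑ c, ind (HX H X a b c) := by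
  obtain ⟨X, -, hX⟩ := Finset.exists_max_image (univ : Finset (Finset (V × V)))
    (fun X => T (HX H X) - δ * n * (X.card : ℝ)) ⟨∅, Finset.mem_univ _⟩
  refine ⟨X, ?_, ?_⟩
  · have h := hX univ (Finset.mem_univ _)
    have e : HX H (univ : Finset (V × V)) = H := by
      funext a b c; simp [HX]
    rw [e, Finset.card_univ, Fintype.card_prod] at h
    push_cast at h
    rw [← hn] at h
    have : 0 ≤ δ * n * (X.card : ℝ) := by rw [hn]; positivity
    nlinarith
  · intro a b hab
    have h := hX (X.erase (a, b)) (Finset.mem_univ _)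
    have h2 := T_erase (H := H) rot X a b
    have h3 : (((X.erase (a, b)).card : ℕ) : ℝ) = X.card - 1 := by
      rw [Finset.card_erase_of_mem hab, Nat.cast_sub (Finset.card_pos.2 ⟨_, hab⟩)]; simp
    simp only [h3] at h
    nlinarith

theorem ball_big {X : Finset (V × V)} {m : ℝ} (hm : 0 ≤ m)
    (hX : ∀ a b, (a, b) ∈ X → m ≤ ∑ c, ind (HX H X a b c)) {x : V × V} (hx : x ∈ X) :
    m ^ 2 ≤ (((univ.filter fun q => Wk H 2 x q).card : ℕ) : ℝ) := by
  obtain ⟨a, b⟩ := x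
  rw [← sum_ind_card, Fintype.sum_prod_type]
  have h1 : ∑ c, ∑ e, ind (HX H X a b c) * ind (HX H X b c e) ≤
      ∑ c, ∑ e, ind (Wk H 2 (a, b) (c, e)) := by
    refine Finset.sum_le_sum fun c _ => Finset.sum_le_sum fun e _ => ?_
    rw [← ind_and]
    apply ind_mono
    rintro ⟨g1, g2⟩
    exact (Wk.one (y := (b, c)) ⟨rfl, g1.1⟩).trans (Wk.one ⟨rfl, g2.1⟩)
  refine le_trans ?_ h1
  have h2 : ∑ c, ind (HX H X a b c) * m ≤ ∑ c, ∑ e, ind (HX H X a b c) * ind (HX H X b c e) := by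
    refine Finset.sum_le_sum fun c _ => ?_
    rw [← Finset.mul_sum]
    by_cases h : HX H X a b c
    · have := hX b c h.2.2.1
      rw [ind_true h]; linarith
    · rw [ind_false h]; simp
  refine le_trans ?_ h2
  rw [← Finset.sum_mul]
  have := hX a b hx
  nlinarith

theorem roots (rot : ∀ {a b c}, H a b c → H b c a) {X : Finset (V × V)} {m : ℝ} (hm : 0 ≤ m)
    (hX : ∀ a b, (a, b) ∈ X → m ≤ ∑ c, ind (HX H X a b c)) :
    ∃ I : Finset (V × V), (I.card : ℝ) * m ^ 2 ≤ (Fintype.card V : ℝ) ^ 2 ∧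
      ∀ x ∈ X, ∃ r ∈ I, ∃ l ≤ 6, Wk H l r x := by
  let ball : V × V → Finset (V × V) := fun x => univ.filter fun q => Wk H 2 x q
  obtain ⟨I, hI, hmax⟩ := Finset.exists_max_image
    ((univ : Finset (Finset (V × V))).filter fun I => I ⊆ X ∧ ∀ x ∈ I, ∀ y ∈ I, x ≠ y →
      Disjoint (ball x) (ball y)) (fun I => I.card) ⟨∅, by simp⟩
  simp only [Finset.mem_filter, Finset.mem_univ, true_and] at hI hmax
  refine ⟨I, ?_, ?_⟩
  · have h1 : ((I.biUnion ball).card : ℝ) ≤ (Fintype.card V : ℝ) ^ 2 := by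
      have := Finset.card_le_univ (I.biUnion ball)
      rw [Fintype.card_prod] at this
      have h : ((I.biUnion ball).card : ℝ) ≤ ((Fintype.card V * Fintype.card V : ℕ) : ℝ) := by
        exact_mod_cast this
      push_cast at h
      nlinarith
    rw [Finset.card_biUnion hI.2] at h1
    push_cast at h1
    refine le_trans ?_ h1
    rw [← nsmul_eq_mul]
    exact Finset.card_nsmul_le_sum I _ _ fun x hx => ball_big hm hX (hI.1 hx)
  · intro x hx
    by_cases hxI : x ∈ I
    · exact ⟨x, hxI, 0, by omega, rfl⟩
    by_contra hno
    push Not at hno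
    have hd : ∀ r ∈ I, Disjoint (ball x) (ball r) := by
      intro r hr
      rw [Finset.disjoint_left]
      intro q hq hq'
      simp only [ball, Finset.mem_filter, Finset.mem_univ, true_and] at hq hq'
      exact hno r hr 6 le_rfl (hq'.trans (hq.rev rot))
    have := hmax (insert x I) ⟨Finset.insert_subset hx hI.1, by
      intro u hu v hv huv
      rcases Finset.mem_insert.1 hu with rfl | hu' <;> rcases Finset.mem_insert.1 hv with rfl | hv'
      · exact absurd rfl huv
      · exact hd v hv'
      · exact (hd u hu').symm
      · exact hI.2 u hu' v hv' huv⟩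
    rw [Finset.card_insert_of_notMem hxI] at this
    omega

end

theorem clean (δ : ℝ) (hδ : 0 < δ) : ∃ L : ℕ, ∀ (V : Type) [Fintype V] (H : V → V → V → Prop)
    (_ : ∀ {a b c}, H a b c → H b a c) (_ : ∀ {a b c}, H a b c → H b c a)
    (_ : ∀ {a b c}, H a b c → a ≠ b), NoBad L H →
    ∃ M : Sys V, M.H = H ∧
      T H - T (fun a b c => H a b c ∧ M.Q0 a b ∧ M.Q0 b c ∧ M.Q0 c a) ≤
        δ * (Fintype.card V : ℝ) ^ 3 := by
  refine ⟨4 * (6 * (6 * 7 ^ ⌈36 / δ ^ 2⌉₊)), ?_⟩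
  intro V _ H sw rot ne hb
  obtain ⟨X, hX1, hX2⟩ := clean1 (H := H) rot (δ / 2) (Fintype.card V) rfl (by positivity)
  obtain ⟨I, hI1, hI2⟩ := roots (H := H) rot (m := δ / 6 * (Fintype.card V : ℝ)) (by positivity)
    (fun a b h => by have := hX2 a b h; linarith)
  have hcard : I.card ≤ ⌈36 / δ ^ 2⌉₊ := by
    rcases isEmpty_or_nonempty V with hV | hV
    · have : I = ∅ := Finset.eq_empty_of_isEmpty I
      rw [this]; simp
    · have hn : (0 : ℝ) < Fintype.card V := by exact_mod_cast Fintype.card_pos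
      have : (I.card : ℝ) ≤ 36 / δ ^ 2 := by
        rw [le_div_iff₀ (by positivity)]
        have h2 : (I.card : ℝ) * δ ^ 2 * (Fintype.card V : ℝ) ^ 2 ≤
            36 * (Fintype.card V : ℝ) ^ 2 := by nlinarith
        exact le_of_mul_le_mul_right h2 (by positivity)
      exact_mod_cast this.trans (Nat.le_ceil _)
  obtain ⟨J, D, hD1, hD2, hJ1, hJ2⟩ := sparsify (H := H) (fun x => x ∈ X) I.card I 6 rfl hI2
  have hD3 : D ≤ 6 * 7 ^ ⌈36 / δ ^ 2⌉₊ :=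
    hD2.trans (Nat.mul_le_mul_left _ (Nat.pow_le_pow_right (by norm_num) hcard))
  refine ⟨mkSys hb sw rot ne J D hD1 (by omega) hJ2, rfl, ?_⟩
  set Q : V → V → Prop := (mkSys hb sw rot ne J D hD1 (by omega) hJ2).Q0 with hQ
  have hQ' : ∀ a b, (a, b) ∈ X → (b, a) ∈ X → Q a b := fun a b h1 h2 => ⟨hJ1 _ h1, hJ1 _ h2⟩
  have e1 := sum3_rot (fun a b c => ind (HX H X b a c))
  have e2 := sum3_rot (fun b c a => ind (HX H X b a c))
  have e3 := sum3_swap (fun b a c => ind (HX H X b a c))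
  have e4 : ∑ a, ∑ b, ∑ c, ind (HX H X b a c) = T (HX H X) := by
    rw [Finset.sum_comm]; rfl
  have e5 : ∑ a, ∑ b, ∑ c, ind (H b a c) = T H := by
    rw [Finset.sum_comm]; rfl
  have key : T H + T (HX H X) + ∑ a, ∑ b, ∑ c, ind (HX H X b a c) ≤
      2 * T H + T (fun a b c => H a b c ∧ Q a b ∧ Q b c ∧ Q c a) := by
    unfold T
    simp only [Finset.mul_sum, ← Finset.sum_add_distrib]
    refine Finset.sum_le_sum fun a _ => Finset.sum_le_sum fun b _ => Finset.sum_le_sum fun c _ => ?_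
    by_cases h : H a b c
    · rw [ind_true h]
      by_cases g1 : HX H X a b c
      · by_cases g2 : HX H X b a c
        · have : H a b c ∧ Q a b ∧ Q b c ∧ Q c a :=
            ⟨h, hQ' _ _ g1.2.1 g2.2.1, hQ' _ _ g1.2.2.1 g2.2.2.2, hQ' _ _ g1.2.2.2 g2.2.2.1⟩
          rw [ind_true g1, ind_true g2, ind_true this]; norm_num
        · rw [ind_false g2]
          have := ind_le_one (HX H X a b c)
          have := ind_nonneg (H a b c ∧ Q a b ∧ Q b c ∧ Q c a)
          linarith
      · rw [ind_false g1]
        have := ind_le_one (HX H X b a c)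
        have := ind_nonneg (H a b c ∧ Q a b ∧ Q b c ∧ Q c a)
        linarith
    · have g1 : ¬ HX H X a b c := fun g => h g.1
      have g2 : ¬ HX H X b a c := fun g => h (sw g.1)
      have g3 : ¬ (H a b c ∧ Q a b ∧ Q b c ∧ Q c a) := fun g => h g.1
      rw [ind_false h, ind_false g1, ind_false g2, ind_false g3]; norm_num
  rw [e4] at key
  linarith

end PC

namespace PC
open Finset
set_option linter.unusedSectionVars false

theorem zbt : ∀ x y z a b c : ZMod 3, x = a - b → y = b - c → z = c - a → a + b + c = 1 →
    y = x - 1 ∧ z = y - 1 := by decide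

open Classical

section
variable {V : Type} [Fintype V]

theorem T_le (H : V → V → V → Prop) : T H ≤ (Fintype.card V : ℝ) ^ 3 := by
  have : T H ≤ ∑ _a : V, ∑ _b : V, ∑ _c : V, (1 : ℝ) :=
    Finset.sum_le_sum fun a _ => Finset.sum_le_sum fun b _ => Finset.sum_le_sum fun c _ =>
      ind_le_one _
  refine this.trans (le_of_eq ?_)
  simp; ring

theorem third (S : V → Prop) (n : ℝ) (hn : n = Fintype.card V) (hn1 : 1e6 ≤ n)
    (h1 : 0.62 * n ≤ sz S) (h2 : sz S ≤ 0.65 * n) (u v : V) (huv : S u ∨ S v) :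
    0.34 * n ≤ ∑ w, ind (w ≠ u ∧ w ≠ v ∧ (S u ∨ S w) ∧ (S v ∨ S w) ∧
      bt S u + bt S v + bt S w = 1) := by
  by_cases hb : S u ∧ S v
  · have e := sz_not S
    have : sz (fun w => ¬ S w) ≤ ∑ w, ind (w ≠ u ∧ w ≠ v ∧ (S u ∨ S w) ∧ (S v ∨ S w) ∧
      bt S u + bt S v + bt S w = 1) := by
      refine Finset.sum_le_sum fun w _ => ind_mono fun hw => ?_
      refine ⟨?_, ?_, Or.inl hb.1, Or.inl hb.2, ?_⟩
      · rintro rfl; exact hw hb.1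
      · rintro rfl; exact hw hb.2
      · rw [bt_pos hb.1, bt_pos hb.2, bt_neg hw]; ring
    rw [← hn] at e
    linarith
  · have hs : bt S u + bt S v = 1 := by
      rcases huv with h | h
      · have : ¬ S v := fun g => hb ⟨h, g⟩
        rw [bt_pos h, bt_neg this]; ring
      · have : ¬ S u := fun g => hb ⟨g, h⟩
        rw [bt_pos h, bt_neg this]; ring
    have : ∑ w, (ind (S w) - ind (w = u) - ind (w = v)) ≤
        ∑ w, ind (w ≠ u ∧ w ≠ v ∧ (S u ∨ S w) ∧ (S v ∨ S w) ∧
          bt S u + bt S v + bt S w = 1) := by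
      refine Finset.sum_le_sum fun w _ => ?_
      have g1 := ind_nonneg (w = u)
      have g2 := ind_nonneg (w = v)
      have g3 := ind_nonneg (w ≠ u ∧ w ≠ v ∧ (S u ∨ S w) ∧ (S v ∨ S w) ∧
          bt S u + bt S v + bt S w = 1)
      have g4 := ind_le_one (S w)
      by_cases e1 : w = u
      · rw [ind_true e1]; linarith
      by_cases e2 : w = v
      · rw [ind_true e2]; linarith
      by_cases e3 : S w
      · have : w ≠ u ∧ w ≠ v ∧ (S u ∨ S w) ∧ (S v ∨ S w) ∧
          bt S u + bt S v + bt S w = 1 := ⟨e1, e2, Or.inr e3, Or.inr e3, by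
            rw [hs, bt_pos e3]; ring⟩
        rw [ind_true this]; linarith
      · rw [ind_false e3]; linarith
    simp only [Finset.sum_sub_distrib] at this
    have s1 : ∀ u : V, ∑ w, ind (w = u) = 1 := by intro u; simp [ind]
    rw [s1, s1] at this
    have : sz S - 1 - 1 ≤ _ := this
    linarith

theorem W_transfer (d : V → V → ZMod 3) (hd : Asym d) (Q : V → V → Prop)
    (G : V → V → V → Prop) (hG1 : ∀ a b c, G a b c → Rd d a b c) (hG2 : ∀ a b c, G a b c → Q a b)
    (S : V → Prop) (n : ℝ) (hn : n = Fintype.card V) (hn1 : 1e6 ≤ n)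
    (h1 : 0.62 * n ≤ sz S) (h2 : sz S ≤ 0.65 * n) :
    0.34 * n * W Q d S ≤ T (Rd d) - T G + 3 * n * W (fun _ _ => True) d S := by
  set W1 := W (fun _ _ => True) d S with hW1
  have hW1' : W1 = ∑ u, ∑ v, ind (wrong (fun _ _ => True) d S u v) := rfl
  have e0 : ∑ a : V, ∑ b : V, ∑ c : V, ind (wrong (fun _ _ => True) d S b c) = n * W1 := by
    rw [hW1', hn]; simp
  have e1 := sum3_rot (fun a b c => ind (wrong (fun _ _ => True) d S a b))
  have e2 := sum3_rot (fun b c a => ind (wrong (fun _ _ => True) d S a b))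
  have eT : T (Rd d) - T G = ∑ a, ∑ b, ∑ c, (ind (Rd d a b c) - ind (G a b c)) := by
    unfold T; simp only [Finset.sum_sub_distrib]
  -- bad pairs
  let B : V → V → Prop := fun u v => wrong Q d S u v ∧ ¬ wrong (fun _ _ => True) d S u v
  have k1 : W Q d S ≤ W1 + ∑ u, ∑ v, ind (B u v) := by
    rw [hW1', ← Finset.sum_add_distrib]
    refine Finset.sum_le_sum fun u _ => ?_
    rw [← Finset.sum_add_distrib]
    refine Finset.sum_le_sum fun v _ => ?_
    rw [← ind_congr (Iff.rfl : wrong Q d S u v ↔ _)]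
    refine le_trans (ind_mono fun h => ?_) (ind_or _ _)
    by_cases g : wrong (fun _ _ => True) d S u v
    · exact Or.inl g
    · exact Or.inr ⟨h, g⟩
  have k2 : 0.34 * n * ∑ u, ∑ v, ind (B u v) ≤ ∑ u, ∑ v, ∑ w, ((ind (Rd d u v w) - ind (G u v w))
      + ind (wrong (fun _ _ => True) d S v w) + ind (wrong (fun _ _ => True) d S w u)) := by
    simp only [Finset.mul_sum]
    refine Finset.sum_le_sum fun u _ => Finset.sum_le_sum fun v _ => ?_
    have nn : ∀ w, 0 ≤ ind (Rd d u v w) - ind (G u v w) := fun w =>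
      sub_nonneg.2 (ind_mono (hG1 u v w))
    have n1 := fun w => ind_nonneg (wrong (fun _ _ => True) d S v w)
    have n2 := fun w => ind_nonneg (wrong (fun _ _ => True) d S w u)
    by_cases hB : B u v
    · rw [ind_true hB, mul_one]
      obtain ⟨⟨hne, hS, hnr⟩, hnw⟩ := hB
      refine (third S n hn hn1 h1 h2 u v hS).trans ?_
      refine Finset.sum_le_sum fun w _ => ?_
      have nn := nn w
      have n1 := n1 w
      have n2 := n2 w
      by_cases hw : w ≠ u ∧ w ≠ v ∧ (S u ∨ S w) ∧ (S v ∨ S w) ∧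
          bt S u + bt S v + bt S w = 1
      · rw [ind_true hw]
        obtain ⟨wu, wv, su, sv, hb⟩ := hw
        by_cases g1 : wrong (fun _ _ => True) d S v w
        · rw [ind_true g1]; linarith
        by_cases g2 : wrong (fun _ _ => True) d S w u
        · rw [ind_true g2]; linarith
        have r0 : d u v = bt S u - bt S v := by
          by_contra h; exact hnw ⟨hne, hS, fun g => h g.2⟩
        have r1 : d v w = bt S v - bt S w := by
          by_contra h; exact g1 ⟨wv.symm, sv, fun g => h g.2⟩
        have r2 : d w u = bt S w - bt S u := by
          by_contra h; exact g2 ⟨wu, su.symm, fun g => h g.2⟩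
        have hR : Rd d u v w := ⟨⟨hne, wv.symm, wu⟩, zbt _ _ _ _ _ _ r0 r1 r2 hb⟩
        have hNG : ¬ G u v w := fun g => hnr ⟨hG2 _ _ _ g, r0⟩
        rw [ind_true hR, ind_false hNG]; linarith
      · rw [ind_false hw]; linarith
    · rw [ind_false hB, mul_zero]
      exact Finset.sum_nonneg fun w _ => by linarith [nn w, n1 w, n2 w]
  simp only [Finset.sum_add_distrib] at k2
  rw [← eT] at k2
  have w1 : 0 ≤ W1 := W_nonneg _ _ _
  have hn0 : 0 ≤ n := by linarith
  have k3 := mul_le_mul_of_nonneg_left k1 (show 0 ≤ 0.34 * n by linarith)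
  have := mul_nonneg hn0 w1
  linarith

end

theorem main_rel : ∃ L : ℕ, ∀ (N : ℕ) (V : Type) [Fintype V] (H : V → V → V → Prop)
    (_ : ∀ {a b c}, H a b c → H b a c) (_ : ∀ {a b c}, H a b c → H b c a)
    (_ : ∀ {a b c}, H a b c → a ≠ b), Fintype.card V = N → NoBad L H →
    T H ≤ 6 * (f N : ℝ) + 1e51 := by
  obtain ⟨L, hL⟩ := clean 1e-15 (by norm_num)
  refine ⟨L, fun N => ?_⟩
  induction N using Nat.strong_induction_on with
  | _ N ih =>
  intro V _ H sw rot ne hN hb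
  obtain ⟨n, hn⟩ : ∃ n : ℝ, n = Fintype.card V := ⟨_, rfl⟩
  have hnN : n = (N : ℝ) := by rw [hn, hN]
  have hn0 : 0 ≤ n := by rw [hnN]; positivity
  have hf0 : (0 : ℝ) ≤ (f N : ℝ) := by positivity
  by_cases hsm : n < 1e17
  · have h1 := T_le H
    rw [← hn] at h1
    have h2 : n ^ 3 ≤ (1e17 : ℝ) ^ 3 := pow_le_pow_left₀ hn0 hsm.le 3
    norm_num at h2 ⊢
    linarith
  by_cases hTf : T H ≤ 6 * (f N : ℝ)
  · linarith [show (0 : ℝ) ≤ 1e51 by norm_num]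
  have hbig : 1e17 ≤ n := not_lt.1 hsm
  have hT : 6 * (f N : ℝ) ≤ T H := (not_le.1 hTf).le
  obtain ⟨M, hM, hcl⟩ := hL V H sw rot ne hb
  rw [← hn] at hcl
  obtain ⟨G, hG⟩ : ∃ G : V → V → V → Prop,
    G = fun a b c => H a b c ∧ M.Q0 a b ∧ M.Q0 b c ∧ M.Q0 c a := ⟨_, rfl⟩
  rw [← hG] at hcl
  have hG1 : ∀ a b c, G a b c → Rd M.d a b c := by
    intro a b c h
    rw [hG] at h
    obtain ⟨h, q1, q2, q3⟩ := h
    have h' : M.H a b c := by rw [hM]; exact h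
    exact ⟨⟨ne h, ne (rot h), ne (rot (rot h))⟩,
      M.con h' (M.Q12 (M.Q01 q1)) (M.Q12 (M.Q01 q2)),
      M.con (M.rot h') (M.Q12 (M.Q01 q2)) (M.Q12 (M.Q01 q3))⟩
  have hG2 : ∀ a b c, G a b c → M.Q0 a b := by
    intro a b c h; rw [hG] at h; exact h.2.1
  have hfl := f_lower N
  rw [← hnN] at hfl
  have hGR : T G ≤ T (Rd M.d) :=
    Finset.sum_le_sum fun a _ => Finset.sum_le_sum fun b _ => Finset.sum_le_sum fun c _ =>
      ind_mono (hG1 a b c)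
  have hRd := T_Rd M.d M.as
  have hub := ub M.d M.as
  rw [← hn] at hub
  have hn2 : 0 ≤ n ^ 2 := by positivity
  have hn3 : 1e17 * n ^ 2 ≤ n ^ 3 := by
    have := mul_le_mul_of_nonneg_right hbig hn2
    nlinarith
  have hGlow : 6 * A * n ^ 3 - 2e-15 * n ^ 3 ≤ T G := by
    norm_num at hcl hn3 ⊢
    linarith
  have hp : (2 * A - 1e-15) * (Fintype.card V : ℝ) ^ 3 ≤ p M.d := by
    rw [← hn]
    have : 0 ≤ n ^ 3 := by positivity
    norm_num at hGlow ⊢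
    linarith
  obtain ⟨S0, s1, s2, s3⟩ := stab M.d M.as 1e-15 (by norm_num) (by norm_num)
    (by rw [← hn]; norm_num at hbig ⊢; linarith) hp
  rw [← hn] at s1 s2 s3
  have hn6 : 1e6 ≤ n := by norm_num at hbig ⊢; linarith
  have hWt := W_transfer M.d M.as M.Q0 G hG1 hG2 S0 n hn hn6 s1 s2
  have hW0 : W M.Q0 M.d S0 ≤ 1e-9 * n ^ 2 := by
    have hpos : 0 < n := by norm_num at hbig; linarith
    have h3 : n * W (fun _ _ => True) M.d S0 ≤ n * (3e4 * 1e-15 * n ^ 2) :=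
      mul_le_mul_of_nonneg_left s3 hn0
    have h4 : n * W M.Q0 M.d S0 ≤ n * (1e-9 * n ^ 2) := by
      have : 0 ≤ n ^ 3 := by positivity
      norm_num at h3 hWt hGlow ⊢
      nlinarith
    exact le_of_mul_le_mul_left h4 hpos
  obtain ⟨S, t1, t2, t3⟩ := M.FS S0 n hn hn6 s1 s2 hW0
  rw [hM] at t3
  have hW2 : 0 ≤ 1e-4 * n * W M.Q2 M.d S :=
    mul_nonneg (mul_nonneg (by norm_num) hn0) (W_nonneg _ _ _)
  rw [T_sub (fun a => ¬ S a) H] at t3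
  obtain ⟨k, hk⟩ : ∃ k : ℕ, sz S = (k : ℝ) := ⟨_, sum_ind_card S⟩
  rw [hk] at t1 t2 t3
  have hk1 : 1 ≤ k := by
    have : (0 : ℝ) < k := by norm_num at t1 hbig; linarith
    exact_mod_cast this
  have hk2 : k + 1 ≤ N := by
    have : (k : ℝ) < N := by rw [← hnN]; norm_num at t2 hbig; linarith
    exact_mod_cast this
  have hcs : Fintype.card {a // ¬ S a} = N - k := by
    have h1 := card_sub (fun a : V => ¬ S a)
    have h2 := sz_not S
    have h3 : ((Fintype.card {a // ¬ S a} : ℕ) : ℝ) = (N : ℝ) - k := by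
      rw [h1, ← hk, ← hnN, hn]; exact h2
    have h4 : ((Fintype.card {a // ¬ S a} : ℕ) : ℝ) = ((N - k : ℕ) : ℝ) := by
      rw [h3, Nat.cast_sub (by omega)]
    exact_mod_cast h4
  have hih := ih (N - k) (by omega) {a // ¬ S a} (fun a b c => H a.1 b.1 c.1)
    (fun h => sw h) (fun h => rot h) (fun h e => ne h (congrArg Subtype.val e)) hcs (by
      intro ℓ a1 a2 a3
      rintro ⟨v, hv⟩
      exact hb ℓ a1 a2 a3 ⟨fun i => (v i).1, hv⟩)
  have hfge := f_ge N k hk1 hk2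
  have hfge' : (k : ℝ) * (k - 1) / 2 * (n - k) + (f (N - k) : ℝ) ≤ (f N : ℝ) := by
    have : ((Nat.choose k 2 * (N - k) + f (N - k) : ℕ) : ℝ) ≤ (f N : ℝ) := by exact_mod_cast hfge
    push_cast [Nat.cast_choose_two] at this
    rw [Nat.cast_sub (by omega), ← hnN] at this
    exact this
  obtain ⟨X, hX⟩ : ∃ X : ℝ, X = 1e51 := ⟨_, rfl⟩
  rw [← hX] at hih ⊢
  have hkk : 6 * ((k : ℝ) * (k - 1) / 2 * (n - k)) = 3 * k * (k - 1) * (n - k) := by ring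
  have hih' := add_le_add_left hih (3 * (k : ℝ) * (k - 1) * (n - k) - 1e-4 * n * W M.Q2 M.d S)
  have t4 : T H ≤ 6 * (f (N - k) : ℝ) + X +
      (3 * (k : ℝ) * (k - 1) * (n - k) - 1e-4 * n * W M.Q2 M.d S) := by
    refine t3.trans (le_trans (le_of_eq ?_) hih')
    rw [add_sub_assoc]
    congr!
  clear hih' hih t3
  linarith

end PC

namespace PC
open Finset
set_option linter.unusedSectionVars false

/-- the relation of a hypergraph -/
def Rel {n : ℕ} (H : Finset (Finset (Fin n))) (a b c : Fin n) : Prop := ({a, b, c} : Finset (Fin n)) ∈ H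

theorem six_card {n : ℕ} {x y z : Fin n} (hxy : x ≠ y) (hxz : x ≠ z) (hyz : y ≠ z) :
    ({(x, y, z), (x, z, y), (y, x, z), (y, z, x), (z, x, y), (z, y, x)} :
      Finset (Fin n × Fin n × Fin n)).card = 6 := by
  have h1 := hxy.symm
  have h2 := hxz.symm
  have h3 := hyz.symm
  simp [Finset.card_insert_of_notMem, hxy, hxz, hyz, h1, h2, h3]

theorem six (n : ℕ) (H : Finset (Finset (Fin n))) (hH : ∀ e ∈ H, e.card = 3) :
    6 * (H.card : ℝ) ≤ T (Rel H) := by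
  classical
  have e1 : T (Rel H) = (((univ : Finset (Fin n × Fin n × Fin n)).filter
      (fun t => Rel H t.1 t.2.1 t.2.2)).card : ℝ) := by
    rw [← sum_ind_card, Fintype.sum_prod_type]
    unfold T
    refine Finset.sum_congr rfl fun a _ => ?_
    rw [Fintype.sum_prod_type]
  rw [e1]
  have h := Finset.card_eq_sum_card_fiberwise
    (s := (univ : Finset (Fin n × Fin n × Fin n)).filter (fun t => Rel H t.1 t.2.1 t.2.2))
    (t := H) (f := fun t => ({t.1, t.2.1, t.2.2} : Finset (Fin n)))
    (fun t ht => by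
      have := (Finset.mem_filter.1 (Finset.mem_coe.1 ht)).2
      exact this)
  rw [h]
  push_cast
  have : ∑ e ∈ H, (6 : ℝ) = 6 * (H.card : ℝ) := by simp; ring
  rw [← this]
  refine Finset.sum_le_sum fun e he => ?_
  obtain ⟨x, y, z, hxy, hxz, hyz, rfl⟩ := Finset.card_eq_three.1 (hH e he)
  have h6 := six_card hxy hxz hyz
  have hle := Finset.card_le_card (s := ({(x, y, z), (x, z, y), (y, x, z), (y, z, x), (z, x, y),
    (z, y, x)} : Finset (Fin n × Fin n × Fin n)))
    (t := ((univ : Finset (Fin n × Fin n × Fin n)).filter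
      (fun t => Rel H t.1 t.2.1 t.2.2)).filter
      (fun t => ({t.1, t.2.1, t.2.2} : Finset (Fin n)) = {x, y, z})) (by
    have key : ∀ a b c : Fin n, ({a, b, c} : Finset (Fin n)) = {x, y, z} → (a, b, c) ∈
      ((univ : Finset (Fin n × Fin n × Fin n)).filter
      (fun t => Rel H t.1 t.2.1 t.2.2)).filter
      (fun t => ({t.1, t.2.1, t.2.2} : Finset (Fin n)) = {x, y, z}) := by
      intro a b c h
      refine Finset.mem_filter.2 ⟨Finset.mem_filter.2 ⟨Finset.mem_univ _, ?_⟩, h⟩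
      change ({a, b, c} : Finset (Fin n)) ∈ H
      rw [h]; exact he
    intro t ht
    simp only [Finset.mem_insert, Finset.mem_singleton] at ht
    rcases ht with rfl | rfl | rfl | rfl | rfl | rfl <;> apply key <;>
      (ext w; simp only [Finset.mem_insert, Finset.mem_singleton, or_comm, or_left_comm, or_assoc]))
  rw [h6] at hle
  exact_mod_cast hle

end PC

/-- There are constants `L` and `C` such that every 3-uniform hypergraph on `n` vertices
with no pseudocycle of length `ℓ` for any `ℓ ≤ L` with `3 ∤ ℓ` has at most `f(n) + C`
edges. -/
theorem edge_bound_constant_error :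
    ∃ L C : ℕ, ∀ n : ℕ, ∀ H : Finset (Finset (Fin n)),
      (∀ e ∈ H, e.card = 3) →
      (∀ ℓ : ℕ, 3 ≤ ℓ → ℓ ≤ L → ¬ (3 ∣ ℓ) → ¬ HasPseudocycle H ℓ) →
      H.card ≤ f n + C := by
  obtain ⟨L, hL⟩ := PC.main_rel
  refine ⟨L, 10 ^ 51, fun n H hH hP => ?_⟩
  have h := hL n (Fin n) (PC.Rel H)
    (by intro a b c h; unfold PC.Rel at *; rwa [Finset.insert_comm])
    (by
      intro a b c h; unfold PC.Rel at *
      have e : ({b, c, a} : Finset (Fin n)) = {a, b, c} := by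
        ext x; simp only [Finset.mem_insert, Finset.mem_singleton]; tauto
      rwa [e])
    (by
      rintro a b c h rfl
      have := hH _ h
      have h2 : ({a, a, c} : Finset (Fin n)).card ≤ 2 := by
        rw [Finset.insert_eq_of_mem (by simp)]; exact Finset.card_le_two
      omega)
    (Fintype.card_fin n) (fun ℓ h1 h2 h3 h4 => hP ℓ h1 h2 h3 h4)
  have h6 := PC.six n H hH
  have : (H.card : ℝ) ≤ ((f n + 10 ^ 51 : ℕ) : ℝ) := by
    push_cast
    norm_num at h ⊢
    linarith
  exact_mod_cast this
end

section
/- Let H be a 3-uniform hypergraph containing a pseudocycle of length ℓ for some ℓ ≥ 3. Then for every m ≥ 2ℓ with m ≡ ℓ (mod 3) or m ≡ 2ℓ (mod 3), H contains a pseudocycle of length m. In particular, if ℓ is not divisible by 3, then H contains a pseudocycle of length m for every m ≥ 2ℓ with m not divisible by 3. -/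
theorem hasPseudocycle_of_nat {V : Type} [DecidableEq V] {H : Finset (Finset V)} {m : ℕ}
    (hm : 3 ≤ m) (w : ℕ → V)
    (hw : ∀ i, i < m → ({w i, w (i + 1), w (i + 2)} : Finset V) ∈ H)
    (h0 : w m = w 0) (h1 : w (m + 1) = w 1) : HasPseudocycle H m := by
  haveI : NeZero m := ⟨by omega⟩
  have key : ∀ k, k < m + 2 → w ((k : ZMod m).val) = w k := by
    intro k hk
    rw [ZMod.val_natCast]
    rcases Nat.lt_or_ge k m with h | h
    · rw [Nat.mod_eq_of_lt h]
    · have : k = m ∨ k = m + 1 := by omega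
      rcases this with rfl | rfl
      · rw [Nat.mod_self, h0]
      · rw [Nat.add_mod_left, Nat.mod_eq_of_lt (by omega), h1]
  refine ⟨fun i => w i.val, fun i => ?_⟩
  have hi := ZMod.val_lt i
  have e1 := key (i.val + 1) (by omega)
  have e2 := key (i.val + 2) (by omega)
  push_cast at e1 e2
  rw [ZMod.natCast_zmod_val] at e1 e2
  simp only [e1, e2]
  exact hw _ hi

theorem HasPseudocycle.exists_nat {V : Type} [DecidableEq V] {H : Finset (Finset V)} {m : ℕ}
    (h : HasPseudocycle H m) : ∃ w : ℕ → V,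
    (∀ i, ({w i, w (i + 1), w (i + 2)} : Finset V) ∈ H) ∧ ∀ i, w (m + i) = w i := by
  obtain ⟨v, hv⟩ := h
  refine ⟨fun i => v i, fun i => ?_, fun i => ?_⟩
  · simpa using hv i
  · simp

theorem HasPseudocycle.add_three {V : Type} [DecidableEq V] {H : Finset (Finset V)} {m : ℕ}
    (hm : 3 ≤ m) (h : HasPseudocycle H m) : HasPseudocycle H (m + 3) := by
  obtain ⟨w, hw, hp⟩ := h.exists_nat
  have hw0 := hw 0
  refine hasPseudocycle_of_nat (by omega) (fun i => if i < 3 then w i else w (i - 3)) ?_ ?_ ?_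
  · intro i _
    match i with
    | 0 => simpa using hw0
    | 1 =>
      have : ({w 1, w 2, w 0} : Finset V) = {w 0, w 1, w 2} := by ext; simp; tauto
      simpa [this] using hw0
    | 2 =>
      have : ({w 2, w 0, w 1} : Finset V) = {w 0, w 1, w 2} := by ext; simp; tauto
      simpa [this] using hw0
    | k + 3 =>
      have := hw k
      simpa [show ¬ (k + 3 + 1 < 3) by omega, show ¬ (k + 3 + 2 < 3) by omega,
        show k + 3 + 1 - 3 = k + 1 by omega, show k + 3 + 2 - 3 = k + 2 by omega] using this
  · simpa using hp 0
  · simpa [show ¬ (m + 3 + 1 < 3) by omega, show m + 3 + 1 - 3 = m + 1 by omega] using hp 1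

theorem HasPseudocycle.add_mul {V : Type} [DecidableEq V] {H : Finset (Finset V)} {m : ℕ}
    (hm : 3 ≤ m) (h : HasPseudocycle H m) (k : ℕ) : HasPseudocycle H (m + 3 * k) := by
  induction k with
  | zero => simpa using h
  | succ k ih => exact HasPseudocycle.add_three (m := m + 3 * k) (by omega) ih

theorem HasPseudocycle.double {V : Type} [DecidableEq V] {H : Finset (Finset V)} {m : ℕ}
    (hm : 3 ≤ m) (h : HasPseudocycle H m) : HasPseudocycle H (2 * m) := by
  obtain ⟨w, hw, hp⟩ := h.exists_nat
  refine hasPseudocycle_of_nat (by omega) w (fun i _ => hw i) ?_ ?_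
  · rw [two_mul, hp]; simpa using hp 0
  · rw [two_mul, add_assoc, hp, hp]


/-- If `H` has a pseudocycle of length `ℓ ≥ 3`, then for every `m ≥ 2ℓ` with
`m ≡ ℓ (mod 3)` or `m ≡ 2ℓ (mod 3)`, `H` has a pseudocycle of length `m`. In particular,
if `3 ∤ ℓ` then `H` has a pseudocycle of length `m` for every `m ≥ 2ℓ` with `3 ∤ m`. -/
theorem pseudocycle_lengthening (n : ℕ) (H : Finset (Finset (Fin n)))
    (h3 : ∀ e ∈ H, e.card = 3) (ℓ : ℕ) (hℓ : 3 ≤ ℓ) (hcyc : HasPseudocycle H ℓ) :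
    (∀ m : ℕ, 2 * ℓ ≤ m → (m ≡ ℓ [MOD 3] ∨ m ≡ 2 * ℓ [MOD 3]) → HasPseudocycle H m) ∧
    (¬ (3 ∣ ℓ) → ∀ m : ℕ, 2 * ℓ ≤ m → ¬ (3 ∣ m) → HasPseudocycle H m) := by

  have main : ∀ m : ℕ, 2 * ℓ ≤ m → (m ≡ ℓ [MOD 3] ∨ m ≡ 2 * ℓ [MOD 3]) →
      HasPseudocycle H m := by
    intro m hm h
    unfold Nat.ModEq at h
    rcases h with h | h
    · obtain ⟨k, rfl⟩ : ∃ k, m = ℓ + 3 * k := ⟨(m - ℓ) / 3, by omega⟩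
      exact hcyc.add_mul hℓ k
    · obtain ⟨k, rfl⟩ : ∃ k, m = 2 * ℓ + 3 * k := ⟨(m - 2 * ℓ) / 3, by omega⟩
      exact (hcyc.double hℓ).add_mul (by omega) k
  refine ⟨main, fun h m hm h' => main m hm ?_⟩
  unfold Nat.ModEq
  have a1 : ℓ % 3 = 1 ∨ ℓ % 3 = 2 := by omega
  have a2 : m % 3 = 1 ∨ m % 3 = 2 := by omega
  rcases a1 with a1 | a1 <;> rcases a2 with a2 | a2 <;> omega
end
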